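/- For any bounded measurable function φ on X: N V_n^N(φ) → σ_n²(φ) in probability as N → ∞, and N V_n^N(φ − η_n^N(φ)) → σ_n²(φ − η_n(φ)) in probability as N → ∞. -/

import Mathlib

open MeasureTheory ProbabilityTheory Filter
open scoped ENNReal NNReal Classical

noncomputable section

namespace PFVar

variable {X : Type*} [MeasurableSpace X]

/-- The unnormalized Feynman–Kac measures `γ_p`. -/
def gammaFK (M0 : Measure X) (M : ℕ → Kernel X X) (G : ℕ → X → ℝ) : ℕ → Measure X
  | 0 => M0
  | p + 1 =>
      ((gammaFK M0 M G p).withDensity fun x => ENNReal.ofReal (G p x)).bind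
        (fun x => M (p + 1) x)

/-- `γ_n(φ)`. -/
def gInt (M0 : Measure X) (M : ℕ → Kernel X X) (G : ℕ → X → ℝ) (n : ℕ) (φ : X → ℝ) : ℝ :=
  ∫ x, φ x ∂(gammaFK M0 M G n)

/-- `η_n(φ) = γ_n(φ)/γ_n(1)`. -/
def eInt (M0 : Measure X) (M : ℕ → Kernel X X) (G : ℕ → X → ℝ) (n : ℕ) (φ : X → ℝ) : ℝ :=
  gInt M0 M G n φ / gInt M0 M G n 1

/-- Law of the path `(X_0,…,X_k)` of an inhomogeneous Markov chain with initial law `μ0` and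
transitions `κ`, recorded as an element of `ℕ → Y` (coordinates beyond `k` are junk). -/
def markovPath {Y : Type*} [MeasurableSpace Y] (μ0 : Measure Y) (κ : ℕ → Y → Measure Y) :
    ℕ → Measure (ℕ → Y)
  | 0 => μ0.map fun y _ => y
  | k + 1 =>
      (markovPath μ0 κ k).bind fun ω =>
        (κ (k + 1) (ω k)).map fun y => Function.update ω (k + 1) y

/-- Categorical distribution on `{0,…,m−1} ⊆ ℕ` with weights `w`. -/
def cat (m : ℕ) (w : ℕ → ℝ) : Measure ℕ :=
  (∑ j ∈ Finset.range m, ENNReal.ofReal (w j))⁻¹ •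
    ∑ j ∈ Finset.range m, ENNReal.ofReal (w j) • Measure.dirac j

/-- Uniform distribution on `{0,…,m−1}`. -/
def unif (m : ℕ) : Measure ℕ := cat m fun _ => 1

/-- Extend a finite tuple to `ℕ` with junk values. -/
def padF {Y : Type*} [Nonempty Y] {m : ℕ} (f : Fin m → Y) : ℕ → Y := fun i =>
  if h : i < m then f ⟨i, h⟩ else Classical.arbitrary Y

/-- One resampling/mutation step of the particle filter: given the time-`p` configuration `z`,
the joint law of the ancestor indices `A_p` and the time-`p+1` particle configuration;
each of the `Np (p+1)` new particles independently draws an ancestor from the categorical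
distribution with weights `G p (z j)`, `j < Np p`, and then moves according to `M (p+1)`. -/
def pfStep [Nonempty X] (M : ℕ → Kernel X X) (G : ℕ → X → ℝ) (Np : ℕ → ℕ) (p : ℕ)
    (z : ℕ → X) : Measure ((ℕ → ℕ) × (ℕ → X)) :=
  (Measure.pi fun _ : Fin (Np (p + 1)) =>
      (cat (Np p) fun j => G p (z j)).bind fun a =>
        (M (p + 1) (z a)).map fun x => (a, x)).map fun f =>
    (padF fun i => (f i).1, padF fun i => (f i).2)

/-- The law of the particle system `(ζ, A)` run up to time `k`: the first component is
`ζ : time → particle index → X`, the second is `A : time → particle index → ℕ`, where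
`A p i` is the ancestor index of particle `i` of generation `p+1`. -/
def pfLaw [Nonempty X] (M0 : Measure X) (M : ℕ → Kernel X X) (G : ℕ → X → ℝ)
    (Np : ℕ → ℕ) : ℕ → Measure ((ℕ → ℕ → X) × (ℕ → ℕ → ℕ))
  | 0 =>
      (Measure.pi fun _ : Fin (Np 0) => M0).map fun f =>
        (fun p => if p = 0 then padF f else fun _ => Classical.arbitrary X, fun _ _ => 0)
  | k + 1 =>
      (pfLaw M0 M G Np k).bind fun ω =>
        (pfStep M G Np k (ω.1 k)).map fun az =>
          (Function.update ω.1 (k + 1) az.2, Function.update ω.2 k az.1)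

/-- Eve indices: `eve A 0 i = i` and `eve A (p+1) i = eve A p (A p i)`. -/
def eve (A : ℕ → ℕ → ℕ) : ℕ → ℕ → ℕ
  | 0 => fun i => i
  | p + 1 => fun i => eve A p (A p i)

/-- `η_n^N(φ)`. -/
def etaN (Np : ℕ → ℕ) (n : ℕ) (φ : X → ℝ) (ω : (ℕ → ℕ → X) × (ℕ → ℕ → ℕ)) : ℝ :=
  (Np n : ℝ)⁻¹ * ∑ i ∈ Finset.range (Np n), φ (ω.1 n i)

/-- `γ_n^N(φ)`. -/
def gammaN (G : ℕ → X → ℝ) (Np : ℕ → ℕ) (n : ℕ) (φ : X → ℝ)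
    (ω : (ℕ → ℕ → X) × (ℕ → ℕ → ℕ)) : ℝ :=
  (∏ p ∈ Finset.range n, etaN Np p (G p) ω) * etaN Np n φ ω

/-- The variance estimator `V_n^N(φ)`. -/
def Vest (Np : ℕ → ℕ) (n : ℕ) (φ : X → ℝ) (ω : (ℕ → ℕ → X) × (ℕ → ℕ → ℕ)) : ℝ :=
  etaN Np n φ ω ^ 2 -
    (∏ p ∈ Finset.range n, (Np p : ℝ) / ((Np p : ℝ) - 1)) *
      ((Np n : ℝ) * ((Np n : ℝ) - 1))⁻¹ *
      ∑ i ∈ Finset.range (Np n), ∑ j ∈ Finset.range (Np n),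
        if eve ω.2 n i ≠ eve ω.2 n j then φ (ω.1 n i) * φ (ω.1 n j) else 0

/-- Initial law of the doubled chain used to define `μ_b`. -/
def pairInit (M0 : Measure X) (b : ℕ → Bool) : Measure (X × X) :=
  if b 0 then M0.map fun x => (x, x) else M0.prod M0

/-- Transitions of the doubled chain used to define `μ_b`. -/
def pairKer (M : ℕ → Kernel X X) (b : ℕ → Bool) (p : ℕ) (q : X × X) : Measure (X × X) :=
  if b p then (M p q.1).map fun y => (y, y) else (M p q.1).prod (M p q.2)

/-- `μ_b(φ) = E_b[φ(X_n, X_n') ∏_{p<n} G_p(X_p) G_p(X_p')]`. -/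
def muB (M0 : Measure X) (M : ℕ → Kernel X X) (G : ℕ → X → ℝ) (n : ℕ) (b : ℕ → Bool)
    (φ : X × X → ℝ) : ℝ :=
  ∫ ω, φ (ω n) * ∏ p ∈ Finset.range n, G p (ω p).1 * G p (ω p).2
    ∂(markovPath (pairInit M0 b) (pairKer M b) n)

/-- `φ ⊗ φ`. -/
def tens (φ : X → ℝ) : X × X → ℝ := fun q => φ q.1 * φ q.2

/-- The binary string `e_p`. -/
def eVec (p : ℕ) : ℕ → Bool := fun q => q == p

/-- The zero binary string `0_n`. -/
def zeroVec : ℕ → Bool := fun _ => false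

/-- Extension of a finite binary string to `ℕ → Bool`. -/
def extB (n : ℕ) (b : Fin (n + 1) → Bool) : ℕ → Bool := fun p =>
  if h : p < n + 1 then b ⟨p, h⟩ else false

/-- `v_{p,n}(φ) = (μ_{e_p}(φ⊗φ) − μ_{0_n}(φ⊗φ)) / γ_n(1)²`. -/
def vpn (M0 : Measure X) (M : ℕ → Kernel X X) (G : ℕ → X → ℝ) (n p : ℕ) (φ : X → ℝ) : ℝ :=
  (muB M0 M G n (eVec p) (tens φ) - muB M0 M G n zeroVec (tens φ)) / gInt M0 M G n 1 ^ 2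

/-- `σ_n²(φ) = Σ_{p=0}^n c_p⁻¹ v_{p,n}(φ)`. -/
def sigma2 (M0 : Measure X) (M : ℕ → Kernel X X) (G : ℕ → X → ℝ) (c : ℕ → ℝ) (n : ℕ)
    (φ : X → ℝ) : ℝ :=
  ∑ p ∈ Finset.range (n + 1), (c p)⁻¹ * vpn M0 M G n p φ

/-- Particle numbers `N_p = ⌈c_p N⌉`. -/
def npart (c : ℕ → ℝ) (N : ℕ) (p : ℕ) : ℕ := ⌈c p * (N : ℝ)⌉₊

/-- Backward tracing: `traceAux A n kn j = K_{n-j}` where `K_n = kn`, `K_p = A p (K_{p+1})`. -/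
def traceAux (A : ℕ → ℕ → ℕ) (n kn : ℕ) : ℕ → ℕ
  | 0 => kn
  | j + 1 => A (n - (j + 1)) (traceAux A n kn j)

/-- The deterministic ancestral trace `K¹`: `trace A n kn p = K_p¹` given `K_n¹ = kn`. -/
def trace (A : ℕ → ℕ → ℕ) (n kn : ℕ) : ℕ → ℕ := fun p => traceAux A n kn (n - p)

/-- Conditional law of the broken-lineage trace `(K_0²,…,K_p²)` given `K_p² = v`
(entries above `p` are junk, to be overwritten). -/
def k2Law (G : ℕ → X → ℝ) (Np : ℕ → ℕ) (ω : (ℕ → ℕ → X) × (ℕ → ℕ → ℕ)) (K1 : ℕ → ℕ) :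
    ℕ → ℕ → Measure (ℕ → ℕ)
  | 0 => fun v => Measure.dirac fun q => if q = 0 then v else 0
  | p + 1 => fun v =>
      ((if v = K1 (p + 1) then cat (Np p) fun j => G p (ω.1 p j)
          else Measure.dirac (ω.2 p v)).bind fun w =>
        (k2Law G Np ω K1 p w).map fun f => Function.update f (p + 1) v)

/-- Conditional law of `(K¹, K²)` given the particle system `ω = (ζ, A)`. -/
def kLaw (G : ℕ → X → ℝ) (Np : ℕ → ℕ) (n : ℕ) (ω : (ℕ → ℕ → X) × (ℕ → ℕ → ℕ)) :
    Measure ((ℕ → ℕ) × (ℕ → ℕ)) :=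
  (unif (Np n)).bind fun k1n =>
    (unif (Np n)).bind fun k2n =>
      (k2Law G Np ω (trace ω.2 n k1n) n k2n).map fun k2 => (trace ω.2 n k1n, k2)

/-- Joint law of the particle system together with the tracing variables `(K¹, K²)`. -/
def pfkLaw [Nonempty X] (M0 : Measure X) (M : ℕ → Kernel X X) (G : ℕ → X → ℝ)
    (Np : ℕ → ℕ) (n : ℕ) :
    Measure (((ℕ → ℕ → X) × (ℕ → ℕ → ℕ)) × ((ℕ → ℕ) × (ℕ → ℕ))) :=
  (pfLaw M0 M G Np n).bind fun ω => (kLaw G Np n ω).map fun k => (ω, k)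

/-- `(k¹, k²) ∈ I(b)`. -/
def inI (Np : ℕ → ℕ) (n : ℕ) (b : ℕ → Bool) (k : (ℕ → ℕ) × (ℕ → ℕ)) : Prop :=
  ∀ p ≤ n, k.1 p < Np p ∧ k.2 p < Np p ∧ (k.1 p = k.2 p ↔ b p = true)

/-- The particle approximation `μ_b^N(φ)` (a function of the realization `ω = (ζ, A)`);
the conditional expectation given `(A, ζ)` is the integral with respect to `kLaw`. -/
def muBN (G : ℕ → X → ℝ) (Np : ℕ → ℕ) (n : ℕ) (b : ℕ → Bool) (φ : X × X → ℝ)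
    (ω : (ℕ → ℕ → X) × (ℕ → ℕ → ℕ)) : ℝ :=
  (∏ p ∈ Finset.range (n + 1),
      if b p then (Np p : ℝ) else (Np p : ℝ) / ((Np p : ℝ) - 1)) *
    gammaN G Np n 1 ω ^ 2 *
    ∫ k, (if inI Np n b k then (1 : ℝ) else 0) * φ (ω.1 n (k.1 n), ω.1 n (k.2 n))
      ∂(kLaw G Np n ω)

/-- `v_{p,n}^N(φ)`. -/
def vpnN (G : ℕ → X → ℝ) (Np : ℕ → ℕ) (n p : ℕ) (φ : X → ℝ)
    (ω : (ℕ → ℕ → X) × (ℕ → ℕ → ℕ)) : ℝ :=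
  (muBN G Np n (eVec p) (tens φ) ω - muBN G Np n zeroVec (tens φ) ω) / gammaN G Np n 1 ω ^ 2

/-- `v_n^N(φ) = Σ_{p=0}^n c_p⁻¹ v_{p,n}^N(φ)`. -/
def vnN (G : ℕ → X → ℝ) (Np : ℕ → ℕ) (c : ℕ → ℝ) (n : ℕ) (φ : X → ℝ)
    (ω : (ℕ → ℕ → X) × (ℕ → ℕ → ℕ)) : ℝ :=
  ∑ p ∈ Finset.range (n + 1), (c p)⁻¹ * vpnN G Np n p φ ω

/-- `QAux M G n φ j = Q_{n-j,n}(φ)`. -/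
def QAux (M : ℕ → Kernel X X) (G : ℕ → X → ℝ) (n : ℕ) (φ : X → ℝ) : ℕ → X → ℝ
  | 0 => φ
  | j + 1 => fun x => G (n - (j + 1)) x * ∫ y, QAux M G n φ j y ∂(M (n - j) x)

/-- `Q_{p,n}(φ)` where `Q_p(x, dx') = G_{p-1}(x) M_p(x, dx')`, `Q_{n,n} = Id`,
`Q_{p,n} = Q_{p+1} ⋯ Q_n`. -/
def Qpn (M : ℕ → Kernel X X) (G : ℕ → X → ℝ) (n p : ℕ) (φ : X → ℝ) : X → ℝ :=
  QAux M G n φ (n - p)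

/-- `φ̂ = G_n · φ`. -/
def hatf (G : ℕ → X → ℝ) (n : ℕ) (φ : X → ℝ) : X → ℝ := fun x => G n x * φ x

/-- `γ̂_n(φ) = γ_n(G_n φ)`. -/
def gHatInt (M0 : Measure X) (M : ℕ → Kernel X X) (G : ℕ → X → ℝ) (n : ℕ) (φ : X → ℝ) : ℝ :=
  gInt M0 M G n (hatf G n φ)

/-- `η̂_n(φ) = γ̂_n(φ)/γ̂_n(1)`. -/
def eHatInt (M0 : Measure X) (M : ℕ → Kernel X X) (G : ℕ → X → ℝ) (n : ℕ) (φ : X → ℝ) : ℝ :=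
  gHatInt M0 M G n φ / gHatInt M0 M G n 1

/-- `γ̂_n^N(φ) = γ_n^N(G_n φ)`. -/
def gammaHatN (G : ℕ → X → ℝ) (Np : ℕ → ℕ) (n : ℕ) (φ : X → ℝ)
    (ω : (ℕ → ℕ → X) × (ℕ → ℕ → ℕ)) : ℝ :=
  gammaN G Np n (hatf G n φ) ω

/-- `η̂_n^N(φ) = γ̂_n^N(φ)/γ̂_n^N(1)`. -/
def etaHatN (G : ℕ → X → ℝ) (Np : ℕ → ℕ) (n : ℕ) (φ : X → ℝ)
    (ω : (ℕ → ℕ → X) × (ℕ → ℕ → ℕ)) : ℝ :=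
  gammaHatN G Np n φ ω / gammaHatN G Np n 1 ω

/-- `v̂_{p,n}(φ) = v_{p,n}(φ̂)/η_n(G_n)²`. -/
def vpnHat (M0 : Measure X) (M : ℕ → Kernel X X) (G : ℕ → X → ℝ) (n p : ℕ) (φ : X → ℝ) : ℝ :=
  vpn M0 M G n p (hatf G n φ) / eInt M0 M G n (G n) ^ 2

/-- `σ̂_n²(φ) = Σ_{p=0}^n c_p⁻¹ v̂_{p,n}(φ)`. -/
def sigma2Hat (M0 : Measure X) (M : ℕ → Kernel X X) (G : ℕ → X → ℝ) (c : ℕ → ℝ) (n : ℕ)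
    (φ : X → ℝ) : ℝ :=
  ∑ p ∈ Finset.range (n + 1), (c p)⁻¹ * vpnHat M0 M G n p φ

/-- `V̂_n^N(φ) = V_n^N(φ̂)/η_n^N(G_n)²`. -/
def VestHat (G : ℕ → X → ℝ) (Np : ℕ → ℕ) (n : ℕ) (φ : X → ℝ)
    (ω : (ℕ → ℕ → X) × (ℕ → ℕ → ℕ)) : ℝ :=
  Vest Np n (hatf G n φ) ω / etaN Np n (G n) ω ^ 2

/-- `v̂_{p,n}^N(φ) = v_{p,n}^N(φ̂)/η_n^N(G_n)²`. -/
def vpnHatN (G : ℕ → X → ℝ) (Np : ℕ → ℕ) (n p : ℕ) (φ : X → ℝ)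
    (ω : (ℕ → ℕ → X) × (ℕ → ℕ → ℕ)) : ℝ :=
  vpnN G Np n p (hatf G n φ) ω / etaN Np n (G n) ω ^ 2

/-- `v̂_n^N(φ) = Σ_{p=0}^n c_p⁻¹ v̂_{p,n}^N(φ)`. -/
def vnHatN (G : ℕ → X → ℝ) (Np : ℕ → ℕ) (c : ℕ → ℝ) (n : ℕ) (φ : X → ℝ)
    (ω : (ℕ → ℕ → X) × (ℕ → ℕ → ℕ)) : ℝ :=
  ∑ p ∈ Finset.range (n + 1), (c p)⁻¹ * vpnHatN G Np n p φ ω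


open PFVar MeasureTheory ProbabilityTheory Filter

/-! ### Second-order statistics of i.i.d. samples -/

section Sampling

variable {Y : Type*}

/-- `h ⊗ h'` restricted to the pairs of points that have the same label. -/
def labelPair (e : Y → ℕ) (h h' : Y → ℝ) (q : Y × Y) : ℝ :=
  if e q.1 = e q.2 then h q.1 * h' q.2 else 0

lemma labelPair_one_nonneg (e : Y → ℕ) (q : Y × Y) : 0 ≤ labelPair e 1 1 q := by
  unfold labelPair; split_ifs <;> simp

lemma labelPair_one_le_one (e : Y → ℕ) (q : Y × Y) : labelPair e 1 1 q ≤ 1 := by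
  unfold labelPair; split_ifs <;> simp

lemma labelPair_one_comm (e : Y → ℕ) (x y : Y) :
    labelPair e 1 1 (x, y) = labelPair e 1 1 (y, x) := by
  simp [labelPair, eq_comm]

lemma abs_labelPair_le (e : Y → ℕ) {h h' : Y → ℝ} {C : ℝ} (hC : ∀ y, |h y| ≤ C)
    (hC' : ∀ y, |h' y| ≤ C) (q : Y × Y) :
    |labelPair e h h' q| ≤ C ^ 2 * labelPair e 1 1 q := by
  unfold labelPair
  split_ifs
  · simp only [Pi.one_apply, mul_one, abs_mul, sq]
    exact mul_le_mul (hC _) (hC' _) (abs_nonneg _) ((abs_nonneg _).trans (hC q.1))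
  · simp

variable [MeasurableSpace Y]

lemma measurable_labelPair {e : Y → ℕ} (he : Measurable e) {h h' : Y → ℝ} (hh : Measurable h)
    (hh' : Measurable h') : Measurable (labelPair e h h') :=
  Measurable.ite (measurableSet_eq_fun (he.comp measurable_fst) (he.comp measurable_snd))
    ((hh.comp measurable_fst).mul (hh'.comp measurable_snd)) measurable_const

lemma integrable_of_abs_le {Ω : Type*} [MeasurableSpace Ω] {μ : Measure Ω} [IsFiniteMeasure μ]
    {f : Ω → ℝ} (hf : Measurable f) {C : ℝ} (hC : ∀ x, |f x| ≤ C) : Integrable f μ :=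
  Integrable.of_bound hf.aestronglyMeasurable C (Eventually.of_forall hC)

variable (μ : Measure Y)

/-- The probability that two independent draws have the same label. -/
def coincidence (e : Y → ℕ) : ℝ := ∫ q, labelPair e 1 1 q ∂(μ.prod μ)

lemma coincidence_nonneg (e : Y → ℕ) : 0 ≤ coincidence μ e :=
  integral_nonneg (labelPair_one_nonneg e)

variable [IsProbabilityMeasure μ]

lemma iIndepFun_eval (m : ℕ) :
    iIndepFun (fun (i : Fin m) (y : Fin m → Y) => y i) (Measure.pi fun _ : Fin m => μ) :=
  iIndepFun_pi (μ := fun _ : Fin m => μ) (X := fun _ => id) fun _ => aemeasurable_id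

lemma map_eval_pi (m : ℕ) (i : Fin m) :
    (Measure.pi fun _ : Fin m => μ).map (fun y => y i) = μ :=
  (measurePreserving_eval (fun _ : Fin m => μ) i).map_eq

lemma map_eval_pair {m : ℕ} {i j : Fin m} (hij : i ≠ j) :
    (Measure.pi fun _ : Fin m => μ).map (fun y => (y i, y j)) = μ.prod μ := by
  have h := (indepFun_iff_map_prod_eq_prod_map_map (measurable_pi_apply i).aemeasurable
    (measurable_pi_apply j).aemeasurable).1 ((iIndepFun_eval μ m).indepFun hij)
  rwa [map_eval_pi, map_eval_pi] at h

lemma map_eval_triple {m : ℕ} {i j k : Fin m} (hij : i ≠ j) (hik : i ≠ k) (hjk : j ≠ k) :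
    (Measure.pi fun _ : Fin m => μ).map (fun y => ((y i, y j), y k)) = (μ.prod μ).prod μ := by
  have h := (indepFun_iff_map_prod_eq_prod_map_map
    ((measurable_pi_apply i).prodMk (measurable_pi_apply j)).aemeasurable
    (measurable_pi_apply k).aemeasurable).1
    ((iIndepFun_eval μ m).indepFun_prodMk (fun i => measurable_pi_apply i) i j k hik hjk)
  rwa [map_eval_pi, map_eval_pair μ hij] at h

lemma integral_eval_pair {m : ℕ} {i j : Fin m} (hij : i ≠ j) {F : Y × Y → ℝ}
    (hF : Measurable F) :
    ∫ y, F (y i, y j) ∂(Measure.pi fun _ : Fin m => μ) = ∫ q, F q ∂(μ.prod μ) := by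
  rw [← map_eval_pair μ hij, integral_map (by fun_prop) hF.aestronglyMeasurable]

lemma integrable_labelPair {e : Y → ℕ} (he : Measurable e) {ν : Measure (Y × Y)}
    [IsFiniteMeasure ν] : Integrable (labelPair e 1 1) ν :=
  integrable_of_abs_le (measurable_labelPair he measurable_one measurable_one) (C := 1) fun q => by
    rw [abs_of_nonneg (labelPair_one_nonneg e q)]; exact labelPair_one_le_one e q

/-- Three independent draws share a label with probability at most `δ √δ`, where `δ` is the
probability that two draws do. -/
lemma integral_triple_le {e : Y → ℕ} (he : Measurable e) :
    ∫ q, labelPair e 1 1 (q.2, q.1.1) * labelPair e 1 1 (q.2, q.1.2) ∂((μ.prod μ).prod μ) ≤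
      coincidence μ e * √(coincidence μ e) := by
  set I : Y × Y → ℝ := labelPair e 1 1 with hI
  have hIm : Measurable I := measurable_labelPair he measurable_one measurable_one
  have hI0 : ∀ q, 0 ≤ I q := labelPair_one_nonneg e
  have hI1 : ∀ q, I q ≤ 1 := labelPair_one_le_one e
  have hIi : ∀ y, Integrable (fun x => I (y, x)) μ := fun y =>
    integrable_of_abs_le (hIm.comp measurable_prodMk_left) (C := 1) fun x => by
      rw [abs_of_nonneg (hI0 _)]; exact hI1 _
  set r : Y → ℝ := fun y => ∫ x, I (y, x) ∂μ with hr
  have hr0 : ∀ y, 0 ≤ r y := fun y => integral_nonneg fun x => hI0 _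
  have hr1 : ∀ y, r y ≤ 1 := fun y => by
    calc r y ≤ ∫ _, (1 : ℝ) ∂μ := integral_mono (hIi y) (integrable_const _) fun x => hI1 _
      _ = 1 := by simp
  have hrm : Measurable r := hIm.stronglyMeasurable.integral_prod_right'.measurable
  have hri : Integrable r μ := integrable_of_abs_le hrm (C := 1) fun y => by
    rw [abs_of_nonneg (hr0 _)]; exact hr1 _
  have hδ : coincidence μ e = ∫ y, r y ∂μ := integral_prod _ (integrable_labelPair he)
  have hrδ : ∀ y, r y ≤ √(coincidence μ e) := by
    intro y
    apply Real.le_sqrt_of_sq_le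
    calc r y ^ 2 = ∫ x, I (y, x) * r y ∂μ := by rw [integral_mul_const, sq]
      _ = ∫ x, I (y, x) * r x ∂μ := by
          congr 1; ext x
          by_cases h : e y = e x
          · have : r y = r x := by simp only [hr, hI, labelPair, h, Pi.one_apply]
            rw [this]
          · simp [hI, labelPair, h]
      _ ≤ ∫ x, r x ∂μ := by
          refine integral_mono ?_ hri fun x => mul_le_of_le_one_left (hr0 _) (hI1 _)
          refine integrable_of_abs_le ((hIm.comp measurable_prodMk_left).mul hrm) (C := 1)
            fun x => ?_
          rw [abs_of_nonneg (mul_nonneg (hI0 _) (hr0 _))]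
          exact mul_le_one₀ (hI1 _) (hr0 _) (hr1 _)
      _ = coincidence μ e := hδ.symm
  have hint : Integrable (fun q : (Y × Y) × Y => I (q.2, q.1.1) * I (q.2, q.1.2))
      ((μ.prod μ).prod μ) := by
    refine integrable_of_abs_le (by fun_prop) (C := 1) fun q => ?_
    rw [abs_of_nonneg (mul_nonneg (hI0 _) (hI0 _))]
    exact mul_le_one₀ (hI1 _) (hI0 _) (hI1 _)
  calc ∫ q, I (q.2, q.1.1) * I (q.2, q.1.2) ∂((μ.prod μ).prod μ)
      = ∫ y, r y * r y ∂μ := by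
        rw [integral_prod_symm _ hint]
        congr 1; ext y
        exact integral_prod_mul (fun x => I (y, x)) (fun x => I (y, x))
    _ ≤ ∫ y, r y * √(coincidence μ e) ∂μ := by
        refine integral_mono ?_ (hri.mul_const _) fun y =>
          mul_le_mul_of_nonneg_left (hrδ y) (hr0 y)
        refine integrable_of_abs_le (hrm.mul hrm) (C := 1) fun y => ?_
        rw [abs_of_nonneg (mul_nonneg (hr0 _) (hr0 _))]
        exact mul_le_one₀ (hr1 _) (hr0 _) (hr1 _)
    _ = _ := by rw [integral_mul_const, ← hδ]

lemma integral_chain_le {e : Y → ℕ} (he : Measurable e) {m : ℕ} {i j l : Fin m} (hij : i ≠ j)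
    (hil : i ≠ l) :
    ∫ y, labelPair e 1 1 (y i, y j) * labelPair e 1 1 (y i, y l)
        ∂(Measure.pi fun _ : Fin m => μ) ≤
      (if j = l then coincidence μ e else coincidence μ e * √(coincidence μ e)) := by
  have hIm := measurable_labelPair he (h := 1) (h' := 1) measurable_one measurable_one
  split_ifs with h
  · subst h
    have hsq : ∀ q, labelPair e 1 1 q * labelPair e 1 1 q = labelPair e 1 1 q := fun q => by
      unfold labelPair; split_ifs <;> simp
    simp only [hsq]
    exact (integral_eval_pair μ hij hIm).le
  · refine le_trans (le_of_eq ?_) (integral_triple_le μ he)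
    rw [← map_eval_triple μ h hij.symm hil.symm, integral_map (by fun_prop)]
    exact Measurable.aestronglyMeasurable (by fun_prop)

/-- Variance bound for an off-diagonal second-order statistic of an i.i.d. sample. -/
lemma integral_offDiag_sub_sq_le {e : Y → ℕ} (he : Measurable e) {h h' : Y → ℝ}
    (hh : Measurable h) (hh' : Measurable h') {C : ℝ} (hC : ∀ y, |h y| ≤ C)
    (hC' : ∀ y, |h' y| ≤ C) (m : ℕ) :
    ∫ y, (∑ i, ∑ j, (if i = j then 0 else labelPair e h h' (y i, y j)) -
          m * (m - 1) * ∫ q, labelPair e h h' q ∂(μ.prod μ)) ^ 2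
        ∂(Measure.pi fun _ : Fin m => μ) ≤
      4 * C ^ 4 * (m ^ 2 * coincidence μ e +
        m ^ 3 * (coincidence μ e * √(coincidence μ e))) := by
  set P := Measure.pi fun _ : Fin m => μ with hP
  set δ := coincidence μ e with hδdef
  set τ := δ * √δ with hτdef
  have hδ0 : 0 ≤ δ := coincidence_nonneg μ e
  have hτ0 : 0 ≤ τ := by positivity
  set H := labelPair e h h' with hH
  set I : Y × Y → ℝ := labelPair e 1 1 with hI
  have hHm : Measurable H := measurable_labelPair he hh hh'
  have hIm : Measurable I := measurable_labelPair he measurable_one measurable_one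
  have hI0 : ∀ q, 0 ≤ I q := labelPair_one_nonneg e
  have hI1 : ∀ q, I q ≤ 1 := labelPair_one_le_one e
  have hHI : ∀ q, |H q| ≤ C ^ 2 * I q := abs_labelPair_le e hC hC'
  have hHC : ∀ q, |H q| ≤ C ^ 2 := fun q =>
    (hHI q).trans (mul_le_of_le_one_right (sq_nonneg _) (hI1 q))
  set θ := ∫ q, H q ∂(μ.prod μ) with hθ
  let Z : Fin m × Fin m → (Fin m → Y) → ℝ := fun p y =>
    if p.1 = p.2 then 0 else H (y p.1, y p.2) - θ
  have hZm : ∀ p, Measurable (Z p) := by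
    intro p
    by_cases hp : p.1 = p.2
    · simp only [Z, hp, if_true]; exact measurable_const
    · simp only [Z, hp, if_false]; fun_prop
  have hZb : ∀ p y, |Z p y| ≤ C ^ 2 + |θ| := by
    intro p y
    simp only [Z]
    split_ifs
    · rw [abs_zero]; positivity
    · exact (abs_sub _ _).trans (by gcongr; exact hHC _)
  have hZZ : ∀ p q, Integrable (fun y => Z p y * Z q y) P := fun p q =>
    integrable_of_abs_le ((hZm p).mul (hZm q)) (C := (C ^ 2 + |θ|) * (C ^ 2 + |θ|)) fun y => by
      rw [abs_mul]
      exact mul_le_mul (hZb p y) (hZb q y) (abs_nonneg _) (by positivity)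
  let t : Fin m → Fin m → ℝ := fun j l => if j = l then δ else τ
  have ht0 : ∀ j l, 0 ≤ t j l := fun j l => by simp only [t]; split_ifs <;> assumption
  let b : Fin m × Fin m → Fin m × Fin m → ℝ := fun p q =>
    (if p.1 = q.1 then t p.2 q.2 else 0) + (if p.1 = q.2 then t p.2 q.1 else 0) +
    (if p.2 = q.1 then t p.1 q.2 else 0) + (if p.2 = q.2 then t p.1 q.1 else 0)
  have hite : ∀ (s : Prop) [Decidable s] (j l : Fin m), 0 ≤ if s then t j l else 0 := by
    intro s _ j l; split_ifs
    · exact ht0 j l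
    · exact le_rfl
  have hb0 : ∀ p q, 0 ≤ b p q := fun p q =>
    add_nonneg (add_nonneg (add_nonneg (hite _ _ _) (hite _ _ _)) (hite _ _ _)) (hite _ _ _)
  have hIsymm : ∀ x y, I (x, y) = I (y, x) := labelPair_one_comm e
  have hchain : ∀ i j l : Fin m, i ≠ j → i ≠ l →
      ∫ y, I (y i, y j) * I (y i, y l) ∂P ≤ t j l := fun i j l h1 h2 =>
    integral_chain_le μ he h1 h2
  have key : ∀ p q, ∫ y, Z p y * Z q y ∂P ≤ C ^ 4 * b p q := by
    rintro ⟨i, j⟩ ⟨k, l⟩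
    by_cases hij : i = j
    · simp only [Z, hij, if_true, zero_mul, integral_zero]
      exact mul_nonneg (by positivity) (hb0 _ _)
    by_cases hkl : k = l
    · simp only [Z, hkl, if_true, mul_zero, integral_zero]
      exact mul_nonneg (by positivity) (hb0 _ _)
    simp only [Z, hij, hkl, if_false]
    have hint : ∀ i j : Fin m, Integrable (fun y : Fin m → Y => H (y i, y j)) P := fun i j =>
      integrable_of_abs_le (by fun_prop) fun y => hHC _
    have hHH : Integrable (fun y : Fin m → Y => H (y i, y j) * H (y k, y l)) P :=
      integrable_of_abs_le (by fun_prop) (C := C ^ 2 * C ^ 2) fun y => by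
        rw [abs_mul]
        exact mul_le_mul (hHC _) (hHC _) (abs_nonneg _) (by positivity)
    have hII : Integrable (fun y : Fin m → Y => I (y i, y j) * I (y k, y l)) P :=
      integrable_of_abs_le (by fun_prop) (C := 1) fun y => by
        rw [abs_of_nonneg (mul_nonneg (hI0 _) (hI0 _))]
        exact mul_le_one₀ (hI1 _) (hI0 _) (hI1 _)
    have hcov : ∫ y, (H (y i, y j) - θ) * (H (y k, y l) - θ) ∂P =
        ∫ y, H (y i, y j) * H (y k, y l) ∂P - θ ^ 2 := by
      have h1 : ∀ y : Fin m → Y, (H (y i, y j) - θ) * (H (y k, y l) - θ) =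
          H (y i, y j) * H (y k, y l) - (θ * H (y i, y j) + θ * H (y k, y l) - θ ^ 2) := by
        intro y; ring
      simp_rw [h1]
      rw [integral_sub hHH (by
          exact (((hint i j).const_mul θ).add ((hint k l).const_mul θ)).sub (integrable_const _)),
        integral_sub (by exact ((hint i j).const_mul θ).add ((hint k l).const_mul θ))
          (integrable_const _),
        integral_add ((hint i j).const_mul θ) ((hint k l).const_mul θ), integral_const_mul,
        integral_const_mul, integral_eval_pair μ hij hHm, integral_eval_pair μ hkl hHm]
      simp only [integral_const, probReal_univ, smul_eq_mul]
      rw [← hθ]; ring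
    rw [hcov]
    have hle : ∫ y, H (y i, y j) * H (y k, y l) ∂P ≤
        C ^ 4 * ∫ y, I (y i, y j) * I (y k, y l) ∂P := by
      rw [← integral_const_mul]
      refine integral_mono hHH (hII.const_mul _) fun y => ?_
      refine (le_abs_self _).trans ?_
      rw [abs_mul]
      calc |H (y i, y j)| * |H (y k, y l)| ≤ (C ^ 2 * I (y i, y j)) * (C ^ 2 * I (y k, y l)) :=
            mul_le_mul (hHI _) (hHI _) (abs_nonneg _) (mul_nonneg (by positivity) (hI0 _))
        _ = C ^ 4 * (I (y i, y j) * I (y k, y l)) := by ring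
    have hfin : ∫ y, I (y i, y j) * I (y k, y l) ∂P ≤ b (i, j) (k, l) →
        ∫ y, H (y i, y j) * H (y k, y l) ∂P - θ ^ 2 ≤ C ^ 4 * b (i, j) (k, l) := fun h3 => by
      have := mul_le_mul_of_nonneg_left h3 (by positivity : 0 ≤ C ^ 4)
      nlinarith [sq_nonneg θ]
    have hb : ∀ a1 a2 a3 a4 : ℝ, 0 ≤ a1 → 0 ≤ a2 → 0 ≤ a3 → 0 ≤ a4 →
        a1 ≤ a1 + a2 + a3 + a4 ∧ a2 ≤ a1 + a2 + a3 + a4 ∧ a3 ≤ a1 + a2 + a3 + a4 ∧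
          a4 ≤ a1 + a2 + a3 + a4 := fun a1 a2 a3 a4 h1 h2 h3 h4 =>
      ⟨by linarith, by linarith, by linarith, by linarith⟩
    obtain ⟨b1, b2, b3, b4⟩ := hb _ _ _ _ (hite (i = k) j l) (hite (i = l) j k)
      (hite (j = k) i l) (hite (j = l) i k)
    by_cases hik : i = k
    · apply hfin
      refine le_trans ?_ b1
      rw [if_pos hik]; subst hik
      exact hchain i j l hij hkl
    by_cases hil : i = l
    · apply hfin
      refine le_trans ?_ b2
      rw [if_pos hil]; subst hil
      simp_rw [fun y : Fin m → Y => hIsymm (y k) (y i)]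
      exact hchain i j k hij hik
    by_cases hjk : j = k
    · apply hfin
      refine le_trans ?_ b3
      rw [if_pos hjk]; subst hjk
      simp_rw [fun y : Fin m → Y => hIsymm (y i) (y j)]
      exact hchain j i l (Ne.symm hij) hkl
    by_cases hjl : j = l
    · apply hfin
      refine le_trans ?_ b4
      rw [if_pos hjl]; subst hjl
      simp_rw [fun y : Fin m → Y => hIsymm (y i) (y j), fun y : Fin m → Y => hIsymm (y k) (y j)]
      exact hchain j i k (Ne.symm hij) hjk
    have hind := (iIndepFun_eval μ m).indepFun_prodMk_prodMk (fun i => measurable_pi_apply i)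
      i j k l hik hil hjk hjl
    have hprod := (hind.comp hHm hHm).integral_fun_mul_eq_mul_integral
      (hHm.comp (by fun_prop)).aestronglyMeasurable (hHm.comp (by fun_prop)).aestronglyMeasurable
    simp only [Function.comp] at hprod
    rw [hprod, integral_eval_pair μ hij hHm, integral_eval_pair μ hkl hHm, ← hθ]
    have := mul_nonneg (by positivity : 0 ≤ C ^ 4) (hb0 (i, j) (k, l))
    nlinarith
  have hW : ∀ y : Fin m → Y, (∑ i, ∑ j, (if i = j then 0 else H (y i, y j)) -
      m * (m - 1) * θ) = ∑ p, Z p y := by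
    intro y
    rw [Fintype.sum_prod_type]
    have hrow : ∀ i : Fin m, ∑ j, Z (i, j) y =
        ∑ j, (if i = j then 0 else H (y i, y j)) - (m - 1) * θ := by
      intro i
      have h1 : ∀ j, Z (i, j) y =
          (if i = j then 0 else H (y i, y j)) - (θ - if i = j then θ else 0) := by
        intro j; simp only [Z]; split_ifs <;> simp
      simp_rw [h1, Finset.sum_sub_distrib]
      simp [sub_mul]
    simp_rw [hrow, Finset.sum_sub_distrib]
    simp [mul_assoc]
  simp_rw [hW, sq (∑ p, Z p _), Finset.sum_mul_sum]
  rw [integral_finsetSum _ fun p _ => integrable_finsetSum _ fun q _ => hZZ p q]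
  simp_rw [fun p => integral_finsetSum Finset.univ fun q (_ : q ∈ Finset.univ) => hZZ p q]
  have hT : ∑ j, ∑ l, t j l ≤ m * δ + m ^ 2 * τ := by
    have h1 : ∀ j l, t j l ≤ (if j = l then δ else 0) + τ := by
      intro j l; simp only [t]; split_ifs <;> simp [hτ0]
    refine (Finset.sum_le_sum fun j _ => Finset.sum_le_sum fun l _ => h1 j l).trans ?_
    simp [Finset.sum_add_distrib]
    nlinarith
  have hS : ∑ p, ∑ q, b p q = 4 * (m * ∑ j, ∑ l, t j l) := by
    have s1 : ∑ i : Fin m, ∑ j : Fin m, ∑ k : Fin m, ∑ l : Fin m, (if i = k then t j l else 0) = m * ∑ j, ∑ l, t j l := by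
      have : ∀ i j k : Fin m, ∑ l, (if i = k then t j l else 0) =
          if i = k then ∑ l, t j l else 0 := by
        intro i j k; split_ifs <;> simp
      simp_rw [this]
      simp
    have s2 : ∑ i : Fin m, ∑ j : Fin m, ∑ k : Fin m, ∑ l : Fin m, (if i = l then t j k else 0) = m * ∑ j, ∑ l, t j l := by
      rw [← s1]
      refine Finset.sum_congr rfl fun i _ => Finset.sum_congr rfl fun j _ => ?_
      rw [Finset.sum_comm]
    have s3 : ∑ i : Fin m, ∑ j : Fin m, ∑ k : Fin m, ∑ l : Fin m, (if j = k then t i l else 0) = m * ∑ j, ∑ l, t j l := by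
      rw [← s1, Finset.sum_comm]
    have s4 : ∑ i : Fin m, ∑ j : Fin m, ∑ k : Fin m, ∑ l : Fin m, (if j = l then t i k else 0) = m * ∑ j, ∑ l, t j l := by
      rw [← s2, Finset.sum_comm]
    simp only [b, Fintype.sum_prod_type, Finset.sum_add_distrib]
    rw [s1, s2, s3, s4]; ring
  calc ∑ p, ∑ q, ∫ y, Z p y * Z q y ∂P ≤ ∑ p, ∑ q, C ^ 4 * b p q :=
        Finset.sum_le_sum fun p _ => Finset.sum_le_sum fun q _ => key p q
    _ = C ^ 4 * (4 * (m * ∑ j, ∑ l, t j l)) := by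
        simp_rw [← Finset.mul_sum]; rw [hS]
    _ ≤ C ^ 4 * (4 * (m * (m * δ + m ^ 2 * τ))) := by gcongr
    _ = _ := by ring

/-- Variance bound for the empirical mean of an i.i.d. sample. -/
lemma integral_mean_sub_sq_le {h : Y → ℝ} (hh : Measurable h) {C : ℝ} (hC : ∀ y, |h y| ≤ C)
    {m : ℕ} (hm : 0 < m) :
    ∫ y, ((m : ℝ)⁻¹ * ∑ i, h (y i) - ∫ x, h x ∂μ) ^ 2 ∂(Measure.pi fun _ : Fin m => μ) ≤
      C ^ 2 * (m : ℝ)⁻¹ := by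
  set P := Measure.pi fun _ : Fin m => μ
  have hm0 : (m : ℝ) ≠ 0 := by positivity
  have hLp : MemLp h 2 μ := MemLp.of_bound hh.aestronglyMeasurable C (Eventually.of_forall hC)
  have hvar := variance_sum_pi (μ := fun _ : Fin m => μ) (X := fun _ => h) fun _ => hLp
  have hvarle : Var[h; μ] ≤ C ^ 2 := by
    refine (variance_le_expectation_sq hh.aestronglyMeasurable).trans ?_
    calc ∫ x, (h ^ 2) x ∂μ ≤ ∫ _, C ^ 2 ∂μ := by
          refine integral_mono_of_nonneg (Eventually.of_forall fun x => sq_nonneg _)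
            (integrable_const _) (Eventually.of_forall fun x => ?_)
          exact sq_le_sq' (abs_le.1 (hC x)).1 (abs_le.1 (hC x)).2
      _ = C ^ 2 := by simp
  have hSm : Measurable (∑ i, fun ω : Fin m → Y => h (ω i)) := by
    fun_prop
  have hmean : ∫ y, (∑ i, fun ω : Fin m → Y => h (ω i)) y ∂P = m * ∫ x, h x ∂μ := by
    simp only [Finset.sum_apply]
    rw [integral_finsetSum _ fun i _ => integrable_of_abs_le (by fun_prop) fun y => hC _]
    have : ∀ i : Fin m, ∫ y, h (y i) ∂P = ∫ x, h x ∂μ := fun i => by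
      conv_rhs => rw [← map_eval_pi μ m i]
      rw [integral_map (measurable_pi_apply i).aemeasurable hh.aestronglyMeasurable]
    simp [this]
  rw [variance_eq_integral hSm.aemeasurable, hmean] at hvar
  have : ∀ y : Fin m → Y, ((m : ℝ)⁻¹ * ∑ i, h (y i) - ∫ x, h x ∂μ) ^ 2 = ((m : ℝ)⁻¹) ^ 2 *
      ((∑ i, fun ω : Fin m → Y => h (ω i)) y - m * ∫ x, h x ∂μ) ^ 2 := by
    intro y
    rw [← mul_pow, mul_sub, ← mul_assoc (m : ℝ)⁻¹, inv_mul_cancel₀ hm0, one_mul,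
      Finset.sum_apply]
  simp_rw [this]
  rw [integral_const_mul, hvar]
  simp only [Finset.sum_const, Finset.card_univ, Fintype.card_fin, nsmul_eq_mul]
  calc ((m : ℝ)⁻¹) ^ 2 * (m * Var[h; μ]) ≤ ((m : ℝ)⁻¹) ^ 2 * (m * C ^ 2) := by gcongr
    _ = C ^ 2 * (m : ℝ)⁻¹ := by field_simp

end Sampling

/-! ### Convergence in probability as convergence along a filter -/

section ProbFilter

variable {Ω : Type*} [MeasurableSpace Ω]

/-- The filter on `ℕ × Ω` of the sets whose `N`-th complementary section has `P N`-measure tending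
to zero. A function tends to a constant along it iff it does so in probability. -/
def probFilter (P : ℕ → Measure Ω) : Filter (ℕ × Ω) where
  sets := {S | Tendsto (fun N => P N {ω | (N, ω) ∉ S}) atTop (nhds 0)}
  univ_sets := by simp
  sets_of_superset {S T} hS hST := by
    refine tendsto_of_tendsto_of_tendsto_of_le_of_le tendsto_const_nhds hS (fun _ => bot_le)
      fun N => measure_mono fun ω hω h => hω (hST h)
  inter_sets {S T} hS hT := by
    have h := Tendsto.add hS hT
    rw [add_zero] at h
    refine tendsto_of_tendsto_of_tendsto_of_le_of_le tendsto_const_nhds h (fun _ => bot_le)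
      fun N => (measure_mono fun ω hω => ?_).trans (measure_union_le _ _)
    by_contra hc
    simp only [Set.mem_union, Set.mem_ofPred_eq, not_or, not_not] at hc
    exact hω hc

lemma mem_probFilter {P : ℕ → Measure Ω} {S : Set (ℕ × Ω)} :
    S ∈ probFilter P ↔ Tendsto (fun N => P N {ω | (N, ω) ∉ S}) atTop (nhds 0) := Iff.rfl

lemma tendsto_fst_probFilter (P : ℕ → Measure Ω) : Tendsto Prod.fst (probFilter P) atTop := by
  intro S hS
  refine tendsto_const_nhds.congr' ?_
  filter_upwards [hS] with N hN
  simp [hN]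

lemma tendsto_probFilter_iff {P : ℕ → Measure Ω} {f : ℕ × Ω → ℝ} {a : ℝ} :
    Tendsto f (probFilter P) (nhds a) ↔
      ∀ ε : ℝ, 0 < ε → Tendsto (fun N => P N {ω | ε ≤ |f (N, ω) - a|}) atTop (nhds 0) := by
  rw [Metric.tendsto_nhds]
  refine forall₂_congr fun ε _ => ?_
  rw [Filter.Eventually, mem_probFilter]
  simp [Real.dist_eq]

/-- Conditional Chebyshev inequality: if, given the past, `f` has mean square distance at most `v`
to `g`, where `g → a` and `v → 0` in probability, then `f → a` in probability. -/
lemma tendsto_probFilter_of_conditional {P Q : ℕ → Measure Ω} {Y : ℕ → Type*}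
    [∀ N, MeasurableSpace (Y N)] {R : ∀ N, Ω → Measure (Y N)} {T : ∀ N, Ω → Y N → Ω}
    (hP : ∀ᶠ N in atTop, P N Set.univ ≤ 1) (hR : ∀ᶠ N in atTop, ∀ ω, R N ω Set.univ ≤ 1)
    (hQ : ∀ N s, MeasurableSet s → Q N s ≤ ∫⁻ ω, R N ω (T N ω ⁻¹' s) ∂(P N))
    {f g v : ℕ × Ω → ℝ} {a : ℝ} (hf : ∀ N, Measurable fun ω => f (N, ω))
    (hv : ∀ᶠ x in probFilter P,
      Integrable (fun y => (f (x.1, T x.1 x.2 y) - g x) ^ 2) (R x.1 x.2) ∧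
        ∫ y, (f (x.1, T x.1 x.2 y) - g x) ^ 2 ∂(R x.1 x.2) ≤ v x)
    (hga : Tendsto g (probFilter P) (nhds a)) (hv0 : Tendsto v (probFilter P) (nhds 0)) :
    Tendsto f (probFilter Q) (nhds a) := by
  rw [tendsto_probFilter_iff]
  intro ε hε
  rw [ENNReal.tendsto_nhds_zero]
  intro δ hδ
  obtain ⟨η, hη0, hηδ⟩ := ENNReal.lt_iff_exists_nnreal_btwn.1 (ENNReal.half_pos hδ.ne')
  have hη : (0 : ℝ) < η := by exact_mod_cast hη0
  have hgood : ∀ᶠ x in probFilter P,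
      R x.1 x.2 (T x.1 x.2 ⁻¹' {ω | ε ≤ |f (x.1, ω) - a|}) ≤ η := by
    filter_upwards [hv, Metric.tendsto_nhds.1 hga (ε / 2) (by positivity),
      hv0.eventually (gt_mem_nhds (by positivity : 0 < (ε / 2) ^ 2 * (η : ℝ)))]
      with x ⟨hxi, hxv⟩ hxg hx0
    rw [Real.dist_eq] at hxg
    have hsub : T x.1 x.2 ⁻¹' {ω | ε ≤ |f (x.1, ω) - a|} ⊆
        {y | ENNReal.ofReal ((ε / 2) ^ 2) ≤
          ENNReal.ofReal ((f (x.1, T x.1 x.2 y) - g x) ^ 2)} := by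
      intro y hy
      simp only [Set.mem_preimage, Set.mem_ofPred_eq] at hy ⊢
      apply ENNReal.ofReal_le_ofReal
      rw [← sq_abs (f _ - _)]
      have := abs_sub_le (f (x.1, T x.1 x.2 y)) (g x) a
      exact pow_le_pow_left₀ (by positivity) (by linarith) 2
    refine (measure_mono hsub).trans ((meas_ge_le_lintegral_div
      hxi.aemeasurable.ennreal_ofReal (by simp; positivity) (by simp)).trans ?_)
    rw [← ofReal_integral_eq_lintegral_ofReal hxi (Eventually.of_forall fun y => sq_nonneg _)]
    refine ENNReal.div_le_of_le_mul ?_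
    rw [← ENNReal.ofReal_coe_nnreal, ← ENNReal.ofReal_mul (by positivity)]
    exact ENNReal.ofReal_le_ofReal (by nlinarith)
  have hgood' := ENNReal.tendsto_nhds_zero.1 (mem_probFilter.1 hgood) (δ / 2)
    (ENNReal.half_pos hδ.ne')
  filter_upwards [hgood', hR, hP] with N hN hRN hPN
  have hbad : MeasurableSet {ω | ε ≤ |f (N, ω) - a|} :=
    measurableSet_le measurable_const ((hf N).sub_const a).abs
  refine (hQ N _ hbad).trans ?_
  set S : Set Ω := {ω | (N, ω) ∉ {x : ℕ × Ω |
    R x.1 x.2 (T x.1 x.2 ⁻¹' {ω | ε ≤ |f (x.1, ω) - a|}) ≤ η}} with hS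
  calc ∫⁻ ω, R N ω (T N ω ⁻¹' {ω | ε ≤ |f (N, ω) - a|}) ∂(P N)
      ≤ ∫⁻ ω, S.indicator 1 ω + η ∂(P N) := by
        refine lintegral_mono fun ω => ?_
        by_cases hω : ω ∈ S
        · rw [Set.indicator_of_mem hω]
          exact ((measure_mono (Set.subset_univ _)).trans (hRN ω)).trans le_self_add
        · simp only [hS, Set.mem_ofPred_eq, not_not] at hω
          exact hω.trans le_add_self
    _ = ∫⁻ ω, S.indicator 1 ω ∂(P N) + ∫⁻ _, (η : ℝ≥0∞) ∂(P N) :=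
        lintegral_add_right _ measurable_const
    _ ≤ δ / 2 + δ / 2 := by
        refine add_le_add ((lintegral_indicator_one_le S).trans hN) ?_
        rw [lintegral_const]
        exact (mul_le_of_le_one_right' hPN).trans hηδ.le
    _ = δ := ENNReal.add_halves δ

end ProbFilter

/-! ### One step of the particle filter -/

section Step

variable {X : Type*} [MeasurableSpace X]

/-- Bounded measurable functions. -/
def BddMeas (φ : X → ℝ) : Prop := Measurable φ ∧ ∃ C, ∀ x, |φ x| ≤ C

lemma BddMeas.one : BddMeas (1 : X → ℝ) := ⟨measurable_one, 1, fun x => by simp⟩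

lemma BddMeas.mul {φ ψ : X → ℝ} (hφ : BddMeas φ) (hψ : BddMeas ψ) :
    BddMeas fun x => φ x * ψ x := by
  obtain ⟨hφm, C, hC⟩ := hφ
  obtain ⟨hψm, D, hD⟩ := hψ
  refine ⟨hφm.mul hψm, C * D, fun x => ?_⟩
  rw [abs_mul]
  exact mul_le_mul (hC x) (hD x) (abs_nonneg _) ((abs_nonneg _).trans (hC x))

lemma BddMeas.comp {Y : Type*} [MeasurableSpace Y] {φ : X → ℝ} (hφ : BddMeas φ) {f : Y → X}
    (hf : Measurable f) : BddMeas fun y => φ (f y) :=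
  ⟨hφ.1.comp hf, hφ.2.choose, fun _ => hφ.2.choose_spec _⟩

lemma BddMeas.const (a : ℝ) : BddMeas fun _ : X => a :=
  ⟨measurable_const, |a|, fun _ => le_rfl⟩

lemma BddMeas.add {φ ψ : X → ℝ} (hφ : BddMeas φ) (hψ : BddMeas ψ) :
    BddMeas fun x => φ x + ψ x := by
  obtain ⟨hφm, C, hC⟩ := hφ
  obtain ⟨hψm, D, hD⟩ := hψ
  exact ⟨hφm.add hψm, C + D, fun x => (abs_add_le _ _).trans (add_le_add (hC x) (hD x))⟩

lemma BddMeas.sub {φ ψ : X → ℝ} (hφ : BddMeas φ) (hψ : BddMeas ψ) :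
    BddMeas fun x => φ x - ψ x := by
  simpa [sub_eq_add_neg] using hφ.add ((BddMeas.const (-1)).mul hψ)

lemma BddMeas.sum {ι : Type*} (s : Finset ι) {φ : ι → X → ℝ} (hφ : ∀ i, BddMeas (φ i)) :
    BddMeas fun x => ∑ i ∈ s, φ i x := by
  induction s using Finset.induction_on with
  | empty => simpa using BddMeas.const 0
  | insert i s hi ih => simpa [Finset.sum_insert hi] using (hφ i).add ih

lemma BddMeas.integrable {φ : X → ℝ} (hφ : BddMeas φ) (μ : Measure X) [IsFiniteMeasure μ] :
    Integrable φ μ :=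
  integrable_of_abs_le hφ.1 hφ.2.choose_spec

lemma BddMeas.integral_kernel {Z : Type*} [MeasurableSpace Z] {φ : X → ℝ} (hφ : BddMeas φ)
    (κ : Kernel Z X) [IsMarkovKernel κ] : BddMeas fun z => ∫ y, φ y ∂(κ z) := by
  obtain ⟨hφm, C, hC⟩ := hφ
  refine ⟨(hφm.stronglyMeasurable.integral_kernel (κ := κ)).measurable, C, fun z => ?_⟩
  have := norm_integral_le_of_norm_le_const (μ := κ z) (f := φ) (C := C)
    (Eventually.of_forall hC)
  simpa using this

/-- The function `G_k · M_{k+1} φ`. -/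
def mutate (M : ℕ → Kernel X X) (G : ℕ → X → ℝ) (k : ℕ) (φ : X → ℝ) : X → ℝ :=
  fun x => G k x * ∫ y, φ y ∂(M (k + 1) x)

lemma BddMeas.mutate {M : ℕ → Kernel X X} [∀ p, IsMarkovKernel (M p)] {G : ℕ → X → ℝ} {k : ℕ}
    (hG : BddMeas (G k)) {φ : X → ℝ} (hφ : BddMeas φ) : BddMeas (mutate M G k φ) :=
  hG.mul (hφ.integral_kernel (M (k + 1)))

lemma mutate_one (M : ℕ → Kernel X X) [∀ p, IsMarkovKernel (M p)] (G : ℕ → X → ℝ) (k : ℕ) :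
    mutate M G k 1 = G k := by
  ext x; simp [mutate]

lemma cat_bind {Z : Type*} [MeasurableSpace Z] (m : ℕ) (w : ℕ → ℝ) (K : ℕ → Measure Z) :
    (cat m w).bind K = (∑ j ∈ Finset.range m, ENNReal.ofReal (w j))⁻¹ •
      ∑ j ∈ Finset.range m, ENNReal.ofReal (w j) • K j := by
  ext s hs
  rw [Measure.bind_apply hs (measurable_of_countable K).aemeasurable, cat, lintegral_smul_measure,
    lintegral_finsetSum_measure]
  simp [lintegral_smul_measure]

/-- Law of the ancestor index and the position of a new particle, given the configuration `z`. -/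
def offspring (M : ℕ → Kernel X X) (G : ℕ → X → ℝ) (m k : ℕ) (z : ℕ → X) : Measure (ℕ × X) :=
  (cat m fun j => G k (z j)).bind fun a => (M (k + 1) (z a)).map fun x => (a, x)

variable {M : ℕ → Kernel X X} [∀ p, IsMarkovKernel (M p)] {G : ℕ → X → ℝ}

lemma isProbabilityMeasure_offspring {m k : ℕ} (hm : 0 < m) (hG : ∀ x, 0 < G k x) (z : ℕ → X) :
    IsProbabilityMeasure (offspring M G m k z) := by
  constructor
  rw [offspring, cat_bind]
  have hK : ∀ j, ((M (k + 1) (z j)).map fun x => (j, x)) Set.univ = 1 := fun j => by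
    rw [Measure.map_apply (by fun_prop) MeasurableSet.univ]; simp
  simp only [Measure.smul_apply, Measure.finsetSum_apply, hK, smul_eq_mul, mul_one]
  refine ENNReal.inv_mul_cancel ?_ (by simp)
  intro h
  rw [Finset.sum_eq_zero_iff] at h
  have := h 0 (Finset.mem_range.2 hm)
  rw [ENNReal.ofReal_eq_zero] at this
  exact (hG _).not_ge this

lemma integral_offspring {m k : ℕ} (hG : ∀ x, 0 < G k x) (z : ℕ → X) {F : ℕ × X → ℝ}
    (hF : BddMeas F) :
    ∫ y, F y ∂(offspring M G m k z) = (∑ j ∈ Finset.range m, G k (z j))⁻¹ *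
      ∑ j ∈ Finset.range m, G k (z j) * ∫ x, F (j, x) ∂(M (k + 1) (z j)) := by
  have hK : ∀ j, IsProbabilityMeasure ((M (k + 1) (z j)).map fun x => (j, x)) := fun j =>
    Measure.isProbabilityMeasure_map (by fun_prop)
  rw [offspring, cat_bind, integral_smul_measure, integral_finsetSum_measure fun j _ =>
      (hF.integrable _).smul_measure (by simp)]
  congr 1
  · rw [← ENNReal.ofReal_sum_of_nonneg fun j _ => (hG _).le, ENNReal.toReal_inv,
      ENNReal.toReal_ofReal (Finset.sum_nonneg fun j _ => (hG _).le)]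
  · refine Finset.sum_congr rfl fun j _ => ?_
    rw [integral_smul_measure, ENNReal.toReal_ofReal (hG _).le, smul_eq_mul,
      integral_map (by fun_prop) hF.1.aestronglyMeasurable]

lemma measurable_label (e : ℕ → ℕ) : Measurable fun y : ℕ × X => e y.1 :=
  (measurable_of_countable e).comp measurable_fst

lemma BddMeas.comp_snd {φ : X → ℝ} (hφ : BddMeas φ) : BddMeas fun y : ℕ × X => φ y.2 :=
  ⟨hφ.1.comp measurable_snd, hφ.2.choose, fun _ => hφ.2.choose_spec _⟩

lemma BddMeas.labelPair {φ ψ : X → ℝ} (hφ : BddMeas φ) (hψ : BddMeas ψ) (e : ℕ → ℕ) :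
    BddMeas (labelPair (fun y : ℕ × X => e y.1) (fun y => φ y.2) (fun y => ψ y.2)) := by
  obtain ⟨C, hC⟩ := hφ.2
  obtain ⟨D, hD⟩ := hψ.2
  refine ⟨measurable_labelPair (measurable_label e) hφ.comp_snd.1 hψ.comp_snd.1,
    max C D ^ 2, fun q => ?_⟩
  refine (abs_labelPair_le _ (C := max C D) (fun y => (hC _).trans (le_max_left _ _))
    (fun y => (hD _).trans (le_max_right _ _)) q).trans ?_
  exact mul_le_of_le_one_right (sq_nonneg _) (labelPair_one_le_one _ q)

lemma integral_offspring_snd {m k : ℕ} (hG : ∀ x, 0 < G k x) (z : ℕ → X) {φ : X → ℝ}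
    (hφ : BddMeas φ) :
    ∫ y, φ y.2 ∂(offspring M G m k z) = (∑ j ∈ Finset.range m, G k (z j))⁻¹ *
      ∑ j ∈ Finset.range m, mutate M G k φ (z j) :=
  integral_offspring hG z hφ.comp_snd

lemma integral_labelPair_offspring {m k : ℕ} (hm : 0 < m) (hG : ∀ x, 0 < G k x) (z : ℕ → X)
    (e : ℕ → ℕ) {φ ψ : X → ℝ} (hφ : BddMeas φ) (hψ : BddMeas ψ) :
    ∫ q, labelPair (fun y : ℕ × X => e y.1) (fun y => φ y.2) (fun y => ψ y.2) q
        ∂((offspring M G m k z).prod (offspring M G m k z)) =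
      (∑ j ∈ Finset.range m, G k (z j))⁻¹ ^ 2 *
        ∑ i ∈ Finset.range m, ∑ j ∈ Finset.range m,
          if e i = e j then mutate M G k φ (z i) * mutate M G k ψ (z j) else 0 := by
  have := isProbabilityMeasure_offspring (M := M) hm hG z
  set ν := offspring M G m k z
  set L := labelPair (fun y : ℕ × X => e y.1) (fun y => φ y.2) (fun y => ψ y.2) with hL
  have hLm : Measurable L := measurable_labelPair (measurable_label e) hφ.comp_snd.1 hψ.comp_snd.1
  have hLb : BddMeas L := by
    obtain ⟨C, hC⟩ := hφ.2
    obtain ⟨D, hD⟩ := hψ.2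
    refine ⟨hLm, max C D ^ 2, fun q => ?_⟩
    refine (abs_labelPair_le _ (C := max C D) (fun y => (hC _).trans (le_max_left _ _))
      (fun y => (hD _).trans (le_max_right _ _)) q).trans ?_
    exact mul_le_of_le_one_right (sq_nonneg _) (labelPair_one_le_one _ q)
  have hLy : ∀ y, BddMeas fun y' => L (y, y') := fun y =>
    ⟨hLm.comp measurable_prodMk_left, hLb.2.choose, fun _ => hLb.2.choose_spec _⟩
  rw [integral_prod _ (hLb.integrable _)]
  have hinner : ∀ y : ℕ × X, ∫ y', L (y, y') ∂ν = (∑ j ∈ Finset.range m, G k (z j))⁻¹ *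
      ∑ j ∈ Finset.range m, if e y.1 = e j then φ y.2 * mutate M G k ψ (z j) else 0 := by
    intro y
    rw [integral_offspring hG z (hLy y)]
    congr 1
    refine Finset.sum_congr rfl fun j _ => ?_
    simp only [hL, labelPair, mutate]
    split_ifs
    · rw [integral_const_mul]; ring
    · simp
  have hinnerb : BddMeas fun y : ℕ × X => ∫ y', L (y, y') ∂ν := by
    refine ⟨hLm.stronglyMeasurable.integral_prod_right'.measurable, hLb.2.choose, fun y => ?_⟩
    have := norm_integral_le_of_norm_le_const (μ := ν) (f := fun y' => L (y, y'))
      (Eventually.of_forall fun y' => hLb.2.choose_spec (y, y'))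
    simpa using this
  rw [integral_offspring hG z hinnerb, sq, mul_assoc]
  congr 1
  rw [Finset.mul_sum]
  refine Finset.sum_congr rfl fun i _ => ?_
  simp_rw [hinner]
  rw [integral_const_mul, mul_left_comm]
  congr 1
  rw [integral_finsetSum _ fun j _ => ?_, Finset.mul_sum]
  · refine Finset.sum_congr rfl fun j _ => ?_
    simp only [mutate]
    split_ifs
    · rw [integral_mul_const]; ring
    · simp
  · split_ifs
    · exact (hφ.integrable _).mul_const _
    · simp

end Step

/-! ### Feynman–Kac measures -/

section FeynmanKac

variable {X : Type*} [MeasurableSpace X]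

lemma integral_bind_kernel {Y Z : Type*} [MeasurableSpace Y] [MeasurableSpace Z] (μ : Measure Y)
    [IsFiniteMeasure μ] (κ : Kernel Y Z) [IsMarkovKernel κ] {F : Z → ℝ} (hF : BddMeas F) :
    ∫ z, F z ∂(μ.bind fun y => κ y) = ∫ y, ∫ z, F z ∂(κ y) ∂μ := by
  have : IsFiniteMeasure (μ.bind fun y => κ y) :=
    inferInstanceAs (IsFiniteMeasure (μ.bind κ))
  have hi := hF.integrable (μ.bind fun y => κ y)
  rw [show (μ.bind fun y => κ y) = (κ ∘ₖ Kernel.const Unit μ) () from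
    Measure.comp_eq_comp_const_apply] at hi ⊢
  rw [Kernel.integral_comp hi, Kernel.const_apply]

variable (M0 : Measure X) [IsProbabilityMeasure M0] (M : ℕ → Kernel X X)
  [∀ p, IsMarkovKernel (M p)] (G : ℕ → X → ℝ)

lemma isFiniteMeasure_gammaFK {k : ℕ} (hG : ∀ p < k, BddMeas (G p)) :
    IsFiniteMeasure (gammaFK M0 M G k) := by
  induction k with
  | zero => unfold gammaFK; infer_instance
  | succ k ih =>
    have := ih fun p hp => hG p (hp.trans k.lt_succ_self)
    have : IsFiniteMeasure ((gammaFK M0 M G k).withDensity fun x => ENNReal.ofReal (G k x)) := by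
      refine isFiniteMeasure_withDensity_ofReal ?_
      exact ((hG k k.lt_succ_self).integrable _).2
    exact inferInstanceAs (IsFiniteMeasure
      (((gammaFK M0 M G k).withDensity fun x => ENNReal.ofReal (G k x)).bind (M (k + 1))))

lemma gInt_succ {k : ℕ} (hG : ∀ p < k + 1, BddMeas (G p)) (hpos : ∀ x, 0 < G k x) {φ : X → ℝ}
    (hφ : BddMeas φ) : gInt M0 M G (k + 1) φ = gInt M0 M G k (mutate M G k φ) := by
  have := isFiniteMeasure_gammaFK M0 M G fun p hp => hG p (hp.trans k.lt_succ_self)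
  have hGk := hG k k.lt_succ_self
  have : IsFiniteMeasure ((gammaFK M0 M G k).withDensity fun x => ENNReal.ofReal (G k x)) :=
    isFiniteMeasure_withDensity_ofReal (hGk.integrable _).2
  unfold gInt
  rw [gammaFK, integral_bind_kernel _ _ hφ]
  rw [integral_withDensity_eq_integral_toReal_smul hGk.1.ennreal_ofReal (by simp)]
  refine integral_congr_ae (Eventually.of_forall fun x => ?_)
  simp [mutate, ENNReal.toReal_ofReal (hpos x).le]

lemma gInt_pos {k : ℕ} (hG : ∀ p < k, BddMeas (G p)) (hpos : ∀ p < k, ∀ x, 0 < G p x) {f : X → ℝ}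
    (hf : BddMeas f) (hf0 : ∀ x, 0 < f x) : 0 < gInt M0 M G k f := by
  induction k generalizing f with
  | zero =>
    simp only [gInt, gammaFK]
    rw [integral_pos_iff_support_of_nonneg (fun x => (hf0 x).le) (hf.integrable _),
      show Function.support f = Set.univ from Set.eq_univ_of_forall fun x => (hf0 x).ne']
    simp
  | succ k ih =>
    have hk := k.lt_succ_self
    rw [gInt_succ M0 M G hG (hpos k hk) hf]
    refine ih (fun p hp => hG p (hp.trans hk)) (fun p hp => hpos p (hp.trans hk))
      (BddMeas.mutate (hG k hk) hf) fun x => mul_pos (hpos k hk x) ?_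
    rw [integral_pos_iff_support_of_nonneg (fun x => (hf0 x).le) (hf.integrable _),
      show Function.support f = Set.univ from Set.eq_univ_of_forall fun x => (hf0 x).ne']
    simp

variable {M0 M G}

lemma eInt_succ {k : ℕ} (hG : ∀ p < k + 1, BddMeas (G p)) (hpos : ∀ p < k + 1, ∀ x, 0 < G p x)
    {φ : X → ℝ} (hφ : BddMeas φ) :
    eInt M0 M G (k + 1) φ = eInt M0 M G k (mutate M G k φ) / eInt M0 M G k (G k) := by
  have hk := k.lt_succ_self
  have h1 := gInt_pos M0 M G (fun p hp => hG p (hp.trans hk)) (fun p hp => hpos p (hp.trans hk))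
    BddMeas.one (fun _ => one_pos)
  unfold eInt
  rw [gInt_succ M0 M G hG (hpos k hk) hφ, gInt_succ M0 M G hG (hpos k hk) BddMeas.one, mutate_one,
    div_div_div_cancel_right₀ h1.ne']

lemma eInt_pos {k : ℕ} (hG : ∀ p < k + 1, BddMeas (G p)) (hpos : ∀ p < k + 1, ∀ x, 0 < G p x) :
    0 < eInt M0 M G k (G k) := by
  have hk := k.lt_succ_self
  exact div_pos (gInt_pos M0 M G (fun p hp => hG p (hp.trans hk))
    (fun p hp => hpos p (hp.trans hk)) (hG k hk) (hpos k hk))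
    (gInt_pos M0 M G (fun p hp => hG p (hp.trans hk)) (fun p hp => hpos p (hp.trans hk))
      BddMeas.one fun _ => one_pos)

variable (M0 M G) in
/-- Limit in probability of `N` times the same-Eve part of `η_k^N(φ) η_k^N(ψ)`. -/
def sameEveLimit (c : ℕ → ℝ) : ℕ → (X → ℝ) → (X → ℝ) → ℝ
  | 0 => fun φ ψ => (c 0)⁻¹ * eInt M0 M G 0 (fun x => φ x * ψ x)
  | k + 1 => fun φ ψ => (c (k + 1))⁻¹ * eInt M0 M G (k + 1) (fun x => φ x * ψ x) +
      sameEveLimit c k (mutate M G k φ) (mutate M G k ψ) / eInt M0 M G k (G k) ^ 2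

end FeynmanKac

/-! ### Convergence of the particle system -/

section Convergence

lemma measurable_padF {Y : Type*} [MeasurableSpace Y] [Nonempty Y] (m : ℕ) :
    Measurable (padF : (Fin m → Y) → ℕ → Y) := by
  refine measurable_pi_iff.2 fun i => ?_
  unfold padF
  split_ifs
  · exact measurable_pi_apply _
  · exact measurable_const

lemma padF_val {Y : Type*} [Nonempty Y] {m : ℕ} (f : Fin m → Y) (i : Fin m) :
    padF f i = f i := by
  simp [padF]

lemma eve_congr {A B : ℕ → ℕ → ℕ} {k : ℕ} (h : ∀ p < k, A p = B p) : eve A k = eve B k := by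
  induction k with
  | zero => rfl
  | succ k ih =>
    ext i
    simp only [eve]
    rw [ih fun p hp => h p (hp.trans k.lt_succ_self), h k k.lt_succ_self]

variable {X : Type*}

/-- The same-Eve part of `η_k^N(φ) η_k^N(ψ)`. -/
def sameEve (Np : ℕ → ℕ) (k : ℕ) (φ ψ : X → ℝ) (ω : (ℕ → ℕ → X) × (ℕ → ℕ → ℕ)) : ℝ :=
  ((Np k : ℝ)⁻¹) ^ 2 * ∑ i ∈ Finset.range (Np k), ∑ j ∈ Finset.range (Np k),
    if eve ω.2 k i = eve ω.2 k j then φ (ω.1 k i) * ψ (ω.1 k j) else 0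

/-- The same-Eve part of `η_k^N(φ) η_k^N(ψ)`, restricted to pairs of distinct particles. -/
def sameEveOff (Np : ℕ → ℕ) (k : ℕ) (φ ψ : X → ℝ) (ω : (ℕ → ℕ → X) × (ℕ → ℕ → ℕ)) : ℝ :=
  ((Np k : ℝ)⁻¹) ^ 2 * ∑ i ∈ Finset.range (Np k), ∑ j ∈ Finset.range (Np k),
    if i = j then 0
    else if eve ω.2 k i = eve ω.2 k j then φ (ω.1 k i) * ψ (ω.1 k j) else 0

lemma sameEve_eq (Np : ℕ → ℕ) (k : ℕ) (φ ψ : X → ℝ) (ω : (ℕ → ℕ → X) × (ℕ → ℕ → ℕ)) :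
    sameEve Np k φ ψ ω = sameEveOff Np k φ ψ ω +
      (Np k : ℝ)⁻¹ * etaN Np k (fun x => φ x * ψ x) ω := by
  have h : ∑ i ∈ Finset.range (Np k), ∑ j ∈ Finset.range (Np k),
      (if eve ω.2 k i = eve ω.2 k j then φ (ω.1 k i) * ψ (ω.1 k j) else 0) =
      (∑ i ∈ Finset.range (Np k), ∑ j ∈ Finset.range (Np k),
        if i = j then 0
        else if eve ω.2 k i = eve ω.2 k j then φ (ω.1 k i) * ψ (ω.1 k j) else 0) +
      ∑ i ∈ Finset.range (Np k), φ (ω.1 k i) * ψ (ω.1 k i) := by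
    rw [← Finset.sum_add_distrib]
    refine Finset.sum_congr rfl fun i hi => ?_
    have h2 : φ (ω.1 k i) * ψ (ω.1 k i) = ∑ j ∈ Finset.range (Np k),
        if i = j then φ (ω.1 k i) * ψ (ω.1 k j) else 0 := by
      rw [Finset.sum_ite_eq, if_pos hi]
    rw [h2, ← Finset.sum_add_distrib]
    refine Finset.sum_congr rfl fun j _ => ?_
    by_cases hij : i = j
    · simp [hij]
    · simp [hij]
  unfold sameEve sameEveOff etaN
  rw [h]; ring

lemma sum_sum_eq_sameEve_div (G : ℕ → X → ℝ) {Np : ℕ → ℕ} {k : ℕ} (hm : 0 < Np k) (φ ψ : X → ℝ)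
    (ω : (ℕ → ℕ → X) × (ℕ → ℕ → ℕ)) :
    (∑ j ∈ Finset.range (Np k), G k (ω.1 k j))⁻¹ ^ 2 *
      ∑ i ∈ Finset.range (Np k), ∑ j ∈ Finset.range (Np k),
        (if eve ω.2 k i = eve ω.2 k j then φ (ω.1 k i) * ψ (ω.1 k j) else 0) =
      sameEve Np k φ ψ ω / etaN Np k (G k) ω ^ 2 := by
  rw [sameEve, etaN, mul_pow, mul_div_mul_left _ _
    (pow_ne_zero _ (inv_ne_zero (Nat.cast_ne_zero.2 hm.ne'))), inv_pow, div_eq_inv_mul]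

lemma sameEveOff_zero (Np : ℕ → ℕ) (φ ψ : X → ℝ) (ω : (ℕ → ℕ → X) × (ℕ → ℕ → ℕ)) :
    sameEveOff Np 0 φ ψ ω = 0 := by
  have h : ∀ i j : ℕ, (if i = j then 0 else if eve ω.2 0 i = eve ω.2 0 j then
      φ (ω.1 0 i) * ψ (ω.1 0 j) else 0) = (0 : ℝ) := fun i j => by
    by_cases hij : i = j <;> simp [eve, hij]
  simp [sameEveOff, h]

section Generations

variable [Nonempty X]

/-- The particle system consisting of the initial generation `y`. -/
def initGen {m : ℕ} (y : Fin m → X) : (ℕ → ℕ → X) × (ℕ → ℕ → ℕ) :=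
  (fun p => if p = 0 then padF y else fun _ => Classical.arbitrary X, fun _ _ => 0)

lemma etaN_initGen (Np : ℕ → ℕ) (φ : X → ℝ) (y : Fin (Np 0) → X) :
    etaN Np 0 φ (initGen y) = (Np 0 : ℝ)⁻¹ * ∑ i, φ (y i) := by
  simp [etaN, initGen, Finset.sum_range, padF_val]

/-- The particle system obtained from `ω` by appending the generation `y`. -/
def appendGen (k : ℕ) {m : ℕ} (ω : (ℕ → ℕ → X) × (ℕ → ℕ → ℕ)) (y : Fin m → ℕ × X) :
    (ℕ → ℕ → X) × (ℕ → ℕ → ℕ) :=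
  (Function.update ω.1 (k + 1) (padF fun i => (y i).2),
    Function.update ω.2 k (padF fun i => (y i).1))

lemma etaN_appendGen (Np : ℕ → ℕ) (k : ℕ) (φ : X → ℝ) (ω : (ℕ → ℕ → X) × (ℕ → ℕ → ℕ))
    (y : Fin (Np (k + 1)) → ℕ × X) :
    etaN Np (k + 1) φ (appendGen k ω y) = (Np (k + 1) : ℝ)⁻¹ * ∑ i, φ (y i).2 := by
  simp [etaN, appendGen, Finset.sum_range, padF_val]

lemma sameEveOff_appendGen (Np : ℕ → ℕ) (k : ℕ) (φ ψ : X → ℝ)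
    (ω : (ℕ → ℕ → X) × (ℕ → ℕ → ℕ)) (y : Fin (Np (k + 1)) → ℕ × X) :
    sameEveOff Np (k + 1) φ ψ (appendGen k ω y) = (Np (k + 1) : ℝ)⁻¹ ^ 2 *
      ∑ i, ∑ j, if i = j then 0 else labelPair (fun y : ℕ × X => eve ω.2 k y.1)
        (fun y => φ y.2) (fun y => ψ y.2) (y i, y j) := by
  have h : eve (Function.update ω.2 k (padF fun i => (y i).1)) k = eve ω.2 k :=
    eve_congr fun p hp => Function.update_of_ne hp.ne _ _
  simp [sameEveOff, appendGen, Finset.sum_range, padF_val, eve, h, labelPair, Fin.val_inj]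

end Generations

variable [MeasurableSpace X]

lemma measurable_eve (k i : ℕ) :
    Measurable fun ω : (ℕ → ℕ → X) × (ℕ → ℕ → ℕ) => eve ω.2 k i := by
  induction k generalizing i with
  | zero => exact measurable_const
  | succ k ih =>
    have h : Measurable fun q : ℕ × ((ℕ → ℕ → X) × (ℕ → ℕ → ℕ)) => eve q.2.2 k q.1 :=
      measurable_from_prod_countable_right fun j => ih j
    have hA : Measurable fun ω : (ℕ → ℕ → X) × (ℕ → ℕ → ℕ) => ω.2 k i :=
      (measurable_pi_apply i).comp ((measurable_pi_apply k).comp measurable_snd)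
    exact h.comp (hA.prodMk measurable_id)

lemma measurable_particle {φ : X → ℝ} (hφ : Measurable φ) (k i : ℕ) :
    Measurable fun ω : (ℕ → ℕ → X) × (ℕ → ℕ → ℕ) => φ (ω.1 k i) :=
  hφ.comp ((measurable_pi_apply i).comp ((measurable_pi_apply k).comp measurable_fst))

lemma measurable_etaN {φ : X → ℝ} (hφ : Measurable φ) (Np : ℕ → ℕ) (k : ℕ) :
    Measurable (etaN Np k φ) :=
  (Finset.measurable_sum _ fun i _ => measurable_particle hφ k i).const_mul _

lemma measurable_sameEveOff {φ ψ : X → ℝ} (hφ : Measurable φ) (hψ : Measurable ψ) (Np : ℕ → ℕ)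
    (k : ℕ) : Measurable (sameEveOff Np k φ ψ) := by
  refine (Finset.measurable_sum _ fun i _ => Finset.measurable_sum _ fun j _ => ?_).const_mul _
  split_ifs
  · exact measurable_const
  · exact Measurable.ite (measurableSet_eq_fun (measurable_eve k i) (measurable_eve k j))
      ((measurable_particle hφ k i).mul (measurable_particle hψ k j)) measurable_const

lemma measurable_updatePair (k : ℕ) (ω : (ℕ → ℕ → X) × (ℕ → ℕ → ℕ)) :
    Measurable fun az : (ℕ → ℕ) × (ℕ → X) =>
      (Function.update ω.1 (k + 1) az.2, Function.update ω.2 k az.1) :=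
  ((measurable_update ω.1).comp measurable_snd).prodMk
    ((measurable_update ω.2).comp measurable_fst)

variable [Nonempty X]

lemma measurable_initGen (m : ℕ) : Measurable (initGen : (Fin m → X) → _) := by
  refine (measurable_pi_iff.2 fun p => ?_).prodMk measurable_const
  split_ifs
  · exact measurable_padF m
  · exact measurable_const

lemma measurable_padPair (m : ℕ) : Measurable fun f : Fin m → ℕ × X =>
    ((padF fun i => (f i).1 : ℕ → ℕ), (padF fun i => (f i).2 : ℕ → X)) := by
  refine ((measurable_padF m).comp ?_).prodMk ((measurable_padF m).comp ?_) <;> fun_prop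

variable (M0 : Measure X) {M : ℕ → Kernel X X} {G : ℕ → X → ℝ}

lemma pfLaw_zero_le (Np : ℕ → ℕ) (ω₀ : (ℕ → ℕ → X) × (ℕ → ℕ → ℕ))
    {s : Set ((ℕ → ℕ → X) × (ℕ → ℕ → ℕ))} (hs : MeasurableSet s) :
    pfLaw M0 M G Np 0 s ≤
      ∫⁻ _, (Measure.pi fun _ : Fin (Np 0) => M0) (initGen ⁻¹' s) ∂(Measure.dirac ω₀) := by
  rw [lintegral_const, measure_univ, mul_one]
  exact (Measure.map_apply (measurable_initGen _) hs).le

lemma pfLaw_succ_le (Np : ℕ → ℕ) (k : ℕ) {s : Set ((ℕ → ℕ → X) × (ℕ → ℕ → ℕ))}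
    (hs : MeasurableSet s) :
    pfLaw M0 M G Np (k + 1) s ≤ ∫⁻ ω, (Measure.pi fun _ : Fin (Np (k + 1)) =>
      offspring M G (Np k) k (ω.1 k)) (appendGen k ω ⁻¹' s) ∂(pfLaw M0 M G Np k) := by
  rw [pfLaw]
  refine (Measure.bind_apply_le _ hs).trans (lintegral_mono fun ω => ?_)
  rw [Measure.map_apply (measurable_updatePair k ω) hs, pfStep,
    Measure.map_apply (measurable_padPair _) (measurable_updatePair k ω hs)]
  exact le_rfl

variable [IsProbabilityMeasure M0] [∀ p, IsMarkovKernel (M p)]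

lemma pfLaw_univ_le {Np : ℕ → ℕ} {k : ℕ} (hNp : ∀ p < k, 0 < Np p)
    (hG : ∀ p < k, ∀ x, 0 < G p x) : pfLaw M0 M G Np k Set.univ ≤ 1 := by
  induction k with
  | zero =>
    rw [pfLaw]
    by_cases h : AEMeasurable (fun f : Fin (Np 0) → X =>
      ((fun p => if p = 0 then padF f else fun _ => Classical.arbitrary X,
        fun _ _ => 0) : (ℕ → ℕ → X) × (ℕ → ℕ → ℕ))) (Measure.pi fun _ : Fin (Np 0) => M0)
    · rw [Measure.map_apply_of_aemeasurable h MeasurableSet.univ]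
      simp
    · rw [Measure.map_of_not_aemeasurable h]; simp
  | succ k ih =>
    refine (pfLaw_succ_le M0 Np k MeasurableSet.univ).trans ?_
    have hk := k.lt_succ_self
    refine le_trans (lintegral_mono (g := fun _ => 1) fun ω => ?_) ?_
    · have := isProbabilityMeasure_offspring (M := M) (hNp k hk) (hG k hk) (ω.1 k)
      exact prob_le_one
    · rw [lintegral_one]
      exact ih (fun p hp => hNp p (hp.trans hk)) (fun p hp => hG p (hp.trans hk))

variable {M0}

lemma integral_etaN_appendGen_sub_sq_le {Np : ℕ → ℕ} {k : ℕ} (hm : 0 < Np k)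
    (hm' : 0 < Np (k + 1)) (hG : ∀ x, 0 < G k x) (ω : (ℕ → ℕ → X) × (ℕ → ℕ → ℕ)) {φ : X → ℝ}
    (hφ : Measurable φ) {C : ℝ} (hC : ∀ x, |φ x| ≤ C) :
    Integrable (fun y => (etaN Np (k + 1) φ (appendGen k ω y) -
        etaN Np k (mutate M G k φ) ω / etaN Np k (G k) ω) ^ 2)
        (Measure.pi fun _ : Fin (Np (k + 1)) => offspring M G (Np k) k (ω.1 k)) ∧
      ∫ y, (etaN Np (k + 1) φ (appendGen k ω y) -
        etaN Np k (mutate M G k φ) ω / etaN Np k (G k) ω) ^ 2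
        ∂(Measure.pi fun _ : Fin (Np (k + 1)) => offspring M G (Np k) k (ω.1 k)) ≤
      C ^ 2 * (Np (k + 1) : ℝ)⁻¹ := by
  have := isProbabilityMeasure_offspring (M := M) hm hG (ω.1 k)
  have hb : BddMeas φ := ⟨hφ, C, hC⟩
  have hmean : etaN Np k (mutate M G k φ) ω / etaN Np k (G k) ω =
      ∫ y, φ y.2 ∂offspring M G (Np k) k (ω.1 k) := by
    rw [integral_offspring_snd hG _ hb, etaN, etaN,
      mul_div_mul_left _ _ (inv_ne_zero (Nat.cast_ne_zero.2 hm.ne')), div_eq_inv_mul]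
  simp_rw [etaN_appendGen]
  rw [hmean]
  refine ⟨BddMeas.integrable ?_ _, integral_mean_sub_sq_le _ hb.comp_snd.1 (fun y => hC y.2) hm'⟩
  have h : BddMeas fun y : Fin (Np (k + 1)) → ℕ × X => (Np (k + 1) : ℝ)⁻¹ * ∑ i, φ (y i).2 -
      ∫ y, φ y.2 ∂offspring M G (Np k) k (ω.1 k) :=
    ((BddMeas.const _).mul (BddMeas.sum _ fun i =>
      hb.comp_snd.comp (measurable_pi_apply i))).sub (BddMeas.const _)
  simpa only [sq] using h.mul h

lemma integral_sameEveOff_appendGen_sub_sq_le {Np : ℕ → ℕ} {k : ℕ} (hm : 0 < Np k)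
    (hm' : 0 < Np (k + 1)) (hG : ∀ x, 0 < G k x) (ω : (ℕ → ℕ → X) × (ℕ → ℕ → ℕ)) {φ ψ : X → ℝ}
    (hφ : Measurable φ) (hψ : Measurable ψ) {C : ℝ} (hC : ∀ x, |φ x| ≤ C) (hC' : ∀ x, |ψ x| ≤ C)
    {δ θ : ℝ} (hδ : δ = sameEve Np k (G k) (G k) ω / etaN Np k (G k) ω ^ 2)
    (hθ : θ = sameEve Np k (mutate M G k φ) (mutate M G k ψ) ω / etaN Np k (G k) ω ^ 2) (r : ℝ) :
    Integrable (fun y => (r * sameEveOff Np (k + 1) φ ψ (appendGen k ω y) -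
        (1 - (Np (k + 1) : ℝ)⁻¹) * (r * θ)) ^ 2)
        (Measure.pi fun _ : Fin (Np (k + 1)) => offspring M G (Np k) k (ω.1 k)) ∧
      ∫ y, (r * sameEveOff Np (k + 1) φ ψ (appendGen k ω y) -
        (1 - (Np (k + 1) : ℝ)⁻¹) * (r * θ)) ^ 2
        ∂(Measure.pi fun _ : Fin (Np (k + 1)) => offspring M G (Np k) k (ω.1 k)) ≤
      4 * C ^ 4 * ((r * (Np (k + 1) : ℝ)⁻¹) ^ 2 * δ + r * (Np (k + 1) : ℝ)⁻¹ * (r * δ) * √δ) := by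
  have := isProbabilityMeasure_offspring (M := M) hm hG (ω.1 k)
  have hb : BddMeas φ := ⟨hφ, C, hC⟩
  have hb' : BddMeas ψ := ⟨hψ, C, hC'⟩
  set ν := offspring M G (Np k) k (ω.1 k)
  set m : ℝ := (Np (k + 1) : ℝ) with hmdef
  have hm0 : m ≠ 0 := Nat.cast_ne_zero.2 hm'.ne'
  have hδ' : coincidence ν (fun y : ℕ × X => eve ω.2 k y.1) = δ := by
    have := integral_labelPair_offspring (M := M) hm hG (ω.1 k) (eve ω.2 k)
      (BddMeas.one (X := X)) BddMeas.one
    rw [mutate_one, sum_sum_eq_sameEve_div G hm] at this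
    rw [hδ, ← this]; rfl
  have hθ' : ∫ q, labelPair (fun y : ℕ × X => eve ω.2 k y.1) (fun y => φ y.2) (fun y => ψ y.2) q
      ∂(ν.prod ν) = θ := by
    rw [integral_labelPair_offspring hm hG (ω.1 k) (eve ω.2 k) hb hb',
      sum_sum_eq_sameEve_div G hm, hθ]
  have key := integral_offDiag_sub_sq_le ν (measurable_label (eve ω.2 k)) hb.comp_snd.1
    hb'.comp_snd.1 (fun y => hC y.2) (fun y => hC' y.2) (Np (k + 1))
  rw [hδ', hθ'] at key
  have hfun : ∀ y : Fin (Np (k + 1)) → ℕ × X, (r * sameEveOff Np (k + 1) φ ψ (appendGen k ω y) -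
      (1 - m⁻¹) * (r * θ)) ^ 2 = (r * m⁻¹ ^ 2) ^ 2 *
      (∑ i, ∑ j, (if i = j then 0 else labelPair (fun y : ℕ × X => eve ω.2 k y.1)
        (fun y => φ y.2) (fun y => ψ y.2) (y i, y j)) - m * (m - 1) * θ) ^ 2 := fun y => by
    rw [sameEveOff_appendGen, ← mul_pow, ← hmdef]
    congr 1
    field_simp
  simp_rw [hfun]
  constructor
  · have h : BddMeas fun y : Fin (Np (k + 1)) → ℕ × X =>
        ∑ i, ∑ j, (if i = j then 0 else labelPair (fun y : ℕ × X => eve ω.2 k y.1)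
        (fun y => φ y.2) (fun y => ψ y.2) (y i, y j)) - m * (m - 1) * θ := by
      refine (BddMeas.sum _ fun i => BddMeas.sum _ fun j => ?_).sub (BddMeas.const _)
      split_ifs
      · exact BddMeas.const 0
      · exact (hb.labelPair hb' (eve ω.2 k)).comp
          ((measurable_pi_apply i).prodMk (measurable_pi_apply j))
    refine BddMeas.integrable ?_ _
    simpa only [sq] using (BddMeas.const _).mul (h.mul h)
  · rw [integral_const_mul]
    refine (mul_le_mul_of_nonneg_left key (sq_nonneg _)).trans (le_of_eq ?_)
    rw [← hmdef]
    field_simp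

lemma tendsto_npart_atTop {c : ℕ → ℝ} {p : ℕ} (hc : 0 < c p) :
    Tendsto (fun N => npart c N p) atTop atTop :=
  tendsto_nat_ceil_atTop.comp (tendsto_natCast_atTop_atTop.const_mul_atTop hc)

lemma tendsto_mul_inv_npart {c : ℕ → ℝ} {p : ℕ} (hc : 0 < c p) :
    Tendsto (fun N : ℕ => (N : ℝ) * (npart c N p : ℝ)⁻¹) atTop (nhds (c p)⁻¹) := by
  have h := ((tendsto_nat_ceil_mul_div_atTop hc.le).comp
    (tendsto_natCast_atTop_atTop (R := ℝ))).inv₀ hc.ne'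
  refine h.congr fun N => ?_
  simp [npart, div_eq_mul_inv]

lemma tendsto_inv_npart {c : ℕ → ℝ} {p : ℕ} (hc : 0 < c p) :
    Tendsto (fun N : ℕ => (npart c N p : ℝ)⁻¹) atTop (nhds 0) :=
  tendsto_inv_atTop_zero.comp (tendsto_natCast_atTop_atTop.comp (tendsto_npart_atTop hc))

lemma eventually_npart_pos {c : ℕ → ℝ} {k : ℕ} (hc : ∀ p < k, 0 < c p) :
    ∀ᶠ N in atTop, ∀ p < k, 0 < npart c N p := by
  have h : ∀ᶠ N in atTop, ∀ p ∈ Finset.range k, 0 < npart c N p :=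
    (Finset.eventually_all _).2 fun p hp =>
      (tendsto_npart_atTop (hc p (Finset.mem_range.1 hp))).eventually_gt_atTop 0
  simpa using h

variable (M0 M G) in
/-- Convergence in probability, as a filter on the pairs (particle budget, outcome) of the particle
system run up to time `k`. -/
def pfFilter (c : ℕ → ℝ) (k : ℕ) : Filter (ℕ × ((ℕ → ℕ → X) × (ℕ → ℕ → ℕ))) :=
  probFilter fun N => pfLaw M0 M G (npart c N) k

/-- Consistency of the particle approximations `η_k^N`. -/
lemma tendsto_etaN {c : ℕ → ℝ} {k : ℕ} (hG : ∀ p < k, BddMeas (G p))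
    (hpos : ∀ p < k, ∀ x, 0 < G p x) (hc : ∀ p < k + 1, 0 < c p) {φ : X → ℝ} (hφ : BddMeas φ) :
    Tendsto (fun x => etaN (npart c x.1) k φ x.2) (pfFilter M0 M G c k)
      (nhds (eInt M0 M G k φ)) := by
  induction k generalizing φ with
  | zero =>
    obtain ⟨C, hC⟩ := hφ.2
    set ω₀ : (ℕ → ℕ → X) × (ℕ → ℕ → ℕ) := (fun _ _ => Classical.arbitrary X, fun _ _ => 0)
    refine tendsto_probFilter_of_conditional (P := fun _ => Measure.dirac ω₀)
      (R := fun N _ => Measure.pi fun _ : Fin (npart c N 0) => M0) (T := fun _ _ => initGen)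
      (g := fun _ => eInt M0 M G 0 φ) (v := fun x => C ^ 2 * (npart c x.1 0 : ℝ)⁻¹)
      (Eventually.of_forall fun _ => prob_le_one)
      (Eventually.of_forall fun _ _ => prob_le_one) (fun N s hs => pfLaw_zero_le M0 _ _ hs)
      (fun N => measurable_etaN hφ.1 (npart c N) 0) ?_ tendsto_const_nhds ?_
    · filter_upwards [(tendsto_fst_probFilter _).eventually (eventually_npart_pos hc)] with x hx
      have he : eInt M0 M G 0 φ = ∫ x, φ x ∂M0 := by simp [eInt, gInt, gammaFK]
      simp_rw [etaN_initGen]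
      rw [he]
      refine ⟨BddMeas.integrable ?_ _, integral_mean_sub_sq_le M0 hφ.1 hC (hx 0 one_pos)⟩
      have h : BddMeas fun y : Fin (npart c x.1 0) → X => (npart c x.1 0 : ℝ)⁻¹ * ∑ i, φ (y i) -
          ∫ x, φ x ∂M0 :=
        ((BddMeas.const _).mul (BddMeas.sum _ fun i =>
          hφ.comp (measurable_pi_apply i))).sub (BddMeas.const _)
      simpa only [sq] using h.mul h
    · simpa using ((tendsto_inv_npart (hc 0 one_pos)).comp (tendsto_fst_probFilter _)).const_mul
        (C ^ 2)
  | succ k ih =>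
    obtain ⟨C, hC⟩ := hφ.2
    have hk := k.lt_succ_self
    have ih' : ∀ {ψ : X → ℝ}, BddMeas ψ → Tendsto (fun x => etaN (npart c x.1) k ψ x.2)
        (pfFilter M0 M G c k) (nhds (eInt M0 M G k ψ)) :=
      ih (fun p hp => hG p (hp.trans hk)) (fun p hp => hpos p (hp.trans hk))
        (fun p hp => hc p (hp.trans k.succ.lt_succ_self))
    have hNp := eventually_npart_pos hc
    have hposk := hpos k hk
    rw [eInt_succ hG hpos hφ]
    refine tendsto_probFilter_of_conditional (P := fun N => pfLaw M0 M G (npart c N) k)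
      (R := fun N ω => Measure.pi fun _ : Fin (npart c N (k + 1)) =>
        offspring M G (npart c N k) k (ω.1 k)) (T := fun _ => appendGen k)
      (v := fun x => C ^ 2 * (npart c x.1 (k + 1) : ℝ)⁻¹) ?_ ?_
      (fun N s hs => pfLaw_succ_le M0 _ k hs)
      (fun N => measurable_etaN hφ.1 (npart c N) (k + 1)) ?_
      ((ih' (BddMeas.mutate (hG k hk) hφ)).div (ih' (hG k hk))
        (eInt_pos hG hpos).ne') ?_
    · filter_upwards [hNp] with N hN
      exact pfLaw_univ_le M0 (fun p hp => hN p (hp.trans (by omega)))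
        fun p hp => hpos p (hp.trans hk)
    · filter_upwards [hNp] with N hN ω
      have := isProbabilityMeasure_offspring (M := M) (hN k (by omega)) hposk (ω.1 k)
      exact prob_le_one
    · filter_upwards [(tendsto_fst_probFilter _).eventually hNp] with x hx
      exact integral_etaN_appendGen_sub_sq_le (hx k (by omega)) (hx (k + 1) (by omega)) hposk x.2
        hφ.1 hC
    · simpa using ((tendsto_inv_npart (hc (k + 1) (by omega))).comp
        (tendsto_fst_probFilter _)).const_mul (C ^ 2)

/-- Convergence of the rescaled same-Eve part of `η_k^N(φ) η_k^N(ψ)`. -/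
lemma tendsto_mul_sameEve {c : ℕ → ℝ} {k : ℕ} (hG : ∀ p < k, BddMeas (G p))
    (hpos : ∀ p < k, ∀ x, 0 < G p x) (hc : ∀ p < k + 1, 0 < c p) {φ ψ : X → ℝ} (hφ : BddMeas φ)
    (hψ : BddMeas ψ) :
    Tendsto (fun x => x.1 * sameEve (npart c x.1) k φ ψ x.2) (pfFilter M0 M G c k)
      (nhds (sameEveLimit M0 M G c k φ ψ)) := by
  have hfst : Tendsto Prod.fst (pfFilter M0 M G c k) atTop := tendsto_fst_probFilter _
  have hdiag := ((tendsto_mul_inv_npart (hc k k.lt_succ_self)).comp hfst).mul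
    (tendsto_etaN hG hpos hc (hφ.mul hψ))
  induction k generalizing φ ψ with
  | zero =>
    refine hdiag.congr fun x => ?_
    simp [sameEve_eq, sameEveOff_zero, mul_assoc]
  | succ k ih =>
    have hk := k.lt_succ_self
    have hGk := hG k hk
    have hG' : ∀ p < k, BddMeas (G p) := fun p hp => hG p (hp.trans hk)
    have hpos' : ∀ p < k, ∀ x, 0 < G p x := fun p hp => hpos p (hp.trans hk)
    have hc' : ∀ p < k + 1, 0 < c p := fun p hp => hc p (hp.trans k.succ.lt_succ_self)
    have hfst' : Tendsto Prod.fst (pfFilter M0 M G c k) atTop := tendsto_fst_probFilter _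
    have ih' : ∀ {φ ψ : X → ℝ}, BddMeas φ → BddMeas ψ →
        Tendsto (fun x => x.1 * sameEve (npart c x.1) k φ ψ x.2) (pfFilter M0 M G c k)
        (nhds (sameEveLimit M0 M G c k φ ψ)) := fun hφ hψ =>
      ih hG' hpos' hc' hφ hψ hfst' (((tendsto_mul_inv_npart (hc' k hk)).comp hfst').mul
        (tendsto_etaN hG' hpos' hc' (hφ.mul hψ)))
    have hNp := eventually_npart_pos hc
    have hposk := hpos k hk
    have hden : Tendsto (fun x => etaN (npart c x.1) k (G k) x.2 ^ 2) (pfFilter M0 M G c k)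
        (nhds (eInt M0 M G k (G k) ^ 2)) := (tendsto_etaN hG' hpos' hc' hGk).pow 2
    have hden0 : eInt M0 M G k (G k) ^ 2 ≠ 0 := pow_ne_zero _ (eInt_pos hG hpos).ne'
    have hratio : ∀ {φ ψ : X → ℝ}, BddMeas φ → BddMeas ψ →
        Tendsto (fun x => x.1 * (sameEve (npart c x.1) k φ ψ x.2 /
          etaN (npart c x.1) k (G k) x.2 ^ 2)) (pfFilter M0 M G c k)
        (nhds (sameEveLimit M0 M G c k φ ψ / eInt M0 M G k (G k) ^ 2)) := fun hφ hψ => by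
      exact ((ih' hφ hψ).div hden hden0).congr fun x => mul_div_assoc _ _ _
    have hinv : Tendsto (fun x => (npart c x.1 (k + 1) : ℝ)⁻¹) (pfFilter M0 M G c k) (nhds 0) :=
      (tendsto_inv_npart (hc (k + 1) (by omega))).comp hfst'
    have hrate : Tendsto (fun x => x.1 * (npart c x.1 (k + 1) : ℝ)⁻¹) (pfFilter M0 M G c k)
        (nhds (c (k + 1))⁻¹) := (tendsto_mul_inv_npart (hc (k + 1) (by omega))).comp hfst'
    have hδ := hratio hGk hGk
    have hδ0 : Tendsto (fun x => sameEve (npart c x.1) k (G k) (G k) x.2 /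
        etaN (npart c x.1) k (G k) x.2 ^ 2) (pfFilter M0 M G c k) (nhds 0) := by
      have h := ((tendsto_inv_atTop_zero.comp (tendsto_natCast_atTop_atTop (R := ℝ))).comp
        hfst').mul hδ
      rw [zero_mul] at h
      refine h.congr' ?_
      filter_upwards [hfst'.eventually_gt_atTop 0] with x hx
      have : (x.1 : ℝ) ≠ 0 := Nat.cast_ne_zero.2 hx.ne'
      simp only [Function.comp_apply]
      field_simp
    obtain ⟨C₁, hC₁⟩ := hφ.2
    obtain ⟨C₂, hC₂⟩ := hψ.2
    set C := max C₁ C₂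
    have hoff : Tendsto (fun x => x.1 * sameEveOff (npart c x.1) (k + 1) φ ψ x.2)
        (pfFilter M0 M G c (k + 1)) (nhds (sameEveLimit M0 M G c k (mutate M G k φ)
          (mutate M G k ψ) / eInt M0 M G k (G k) ^ 2)) := by
      have hg := ((tendsto_const_nhds (x := (1 : ℝ))).sub hinv).mul
        (hratio (BddMeas.mutate (M := M) hGk hφ) (BddMeas.mutate (M := M) hGk hψ))
      have hv := (((hrate.pow 2).mul hδ0).add ((hrate.mul hδ).mul hδ0.sqrt)).const_mul (4 * C ^ 4)
      rw [sub_zero, one_mul] at hg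
      rw [Real.sqrt_zero, mul_zero, mul_zero, add_zero, mul_zero] at hv
      refine tendsto_probFilter_of_conditional (P := fun N => pfLaw M0 M G (npart c N) k)
        (R := fun N ω => Measure.pi fun _ : Fin (npart c N (k + 1)) =>
          offspring M G (npart c N k) k (ω.1 k)) (T := fun _ => appendGen k) ?_ ?_
        (fun N s hs => pfLaw_succ_le M0 _ k hs)
        (fun N => (measurable_sameEveOff hφ.1 hψ.1 (npart c N) (k + 1)).const_mul (N : ℝ)) ?_ hg hv
      · filter_upwards [hNp] with N hN
        exact pfLaw_univ_le M0 (fun p hp => hN p (hp.trans (by omega))) hpos'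
      · filter_upwards [hNp] with N hN ω
        have := isProbabilityMeasure_offspring (M := M) (hN k (by omega)) hposk (ω.1 k)
        exact prob_le_one
      · filter_upwards [hfst'.eventually hNp] with x hx
        exact integral_sameEveOff_appendGen_sub_sq_le (hx k (by omega)) (hx (k + 1) (by omega))
          hposk x.2 hφ.1 hψ.1 (fun y => (hC₁ y).trans (le_max_left _ _))
          (fun y => (hC₂ y).trans (le_max_right _ _)) rfl rfl x.1
    refine (hdiag.add hoff).congr fun x => ?_
    simp only [Function.comp_apply, sameEve_eq]
    ring

end Convergence

/-! ### The asymptotic variance -/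

section MarkovPath

variable {Y : Type*} [MeasurableSpace Y] (μ₀ : Measure Y)
  (κ : ℕ → Kernel Y Y) [∀ p, IsMarkovKernel (κ p)]

/-- The kernel extending a path up to time `k` by one step. -/
def pathStep (k : ℕ) : Kernel (ℕ → Y) (ℕ → Y) :=
  (Kernel.id ×ₖ (κ (k + 1)).comap (fun ω : ℕ → Y => ω k) (measurable_pi_apply k)).map
    fun q => Function.update q.1 (k + 1) q.2

lemma pathStep_apply (k : ℕ) (ω : ℕ → Y) :
    pathStep κ k ω = (κ (k + 1) (ω k)).map fun y => Function.update ω (k + 1) y := by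
  rw [pathStep, Kernel.map_apply _ measurable_update', Kernel.prod_apply, Kernel.id_apply,
    Kernel.comap_apply, Measure.dirac_prod, Measure.map_map measurable_update' (by fun_prop)]
  rfl

instance (k : ℕ) : IsMarkovKernel (pathStep κ k) :=
  Kernel.IsMarkovKernel.map _ measurable_update'

lemma markovPath_succ (k : ℕ) : markovPath μ₀ (fun p y => κ p y) (k + 1) =
    (markovPath μ₀ (fun p y => κ p y) k).bind fun ω => pathStep κ k ω := by
  simp only [markovPath, pathStep_apply]

variable [IsProbabilityMeasure μ₀]

instance isProbabilityMeasure_markovPath (k : ℕ) :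
    IsProbabilityMeasure (markovPath μ₀ (fun p y => κ p y) k) := by
  induction k with
  | zero => exact Measure.isProbabilityMeasure_map (by fun_prop)
  | succ k ih =>
    rw [markovPath_succ]
    exact inferInstanceAs (IsProbabilityMeasure
      ((markovPath μ₀ (fun p y => κ p y) k).bind (pathStep κ k)))

lemma integral_markovPath_succ (k : ℕ) {F : (ℕ → Y) → ℝ} (hF : BddMeas F) :
    ∫ ω, F ω ∂(markovPath μ₀ (fun p y => κ p y) (k + 1)) =
      ∫ ω, ∫ y, F (Function.update ω (k + 1) y) ∂(κ (k + 1) (ω k))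
        ∂(markovPath μ₀ (fun p y => κ p y) k) := by
  rw [markovPath_succ, integral_bind_kernel _ _ hF]
  refine integral_congr_ae (Eventually.of_forall fun ω => ?_)
  simp only [pathStep_apply]
  rw [integral_map (measurable_update ω).aemeasurable hF.1.aestronglyMeasurable]

end MarkovPath

section Variance

variable {X : Type*} [MeasurableSpace X]

/-- The transitions of the doubled chain, as kernels. -/
def pairKernel (M : ℕ → Kernel X X) (b : ℕ → Bool) (p : ℕ) : Kernel (X × X) (X × X) :=
  if b p then ((M p).comap Prod.fst measurable_fst).map fun y => (y, y)
  else (M p).comap Prod.fst measurable_fst ×ₖ (M p).comap Prod.snd measurable_snd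

instance (M : ℕ → Kernel X X) [∀ p, IsMarkovKernel (M p)] (b : ℕ → Bool) (p : ℕ) :
    IsMarkovKernel (pairKernel M b p) := by
  unfold pairKernel
  split_ifs
  · exact Kernel.IsMarkovKernel.map _ (by fun_prop)
  · infer_instance

lemma pairKernel_apply (M : ℕ → Kernel X X) [∀ p, IsMarkovKernel (M p)] (b : ℕ → Bool) (p : ℕ)
    (q : X × X) : pairKernel M b p q = pairKer M b p q := by
  unfold pairKernel pairKer
  split_ifs
  · rw [Kernel.map_apply _ (by fun_prop), Kernel.comap_apply]
  · rw [Kernel.prod_apply, Kernel.comap_apply, Kernel.comap_apply]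

instance (M0 : Measure X) [IsProbabilityMeasure M0] (b : ℕ → Bool) :
    IsProbabilityMeasure (pairInit M0 b) := by
  unfold pairInit
  split_ifs
  · exact Measure.isProbabilityMeasure_map (by fun_prop)
  · infer_instance

lemma BddMeas.prod {Y ι : Type*} [MeasurableSpace Y] (s : Finset ι) {φ : ι → Y → ℝ}
    (hφ : ∀ i ∈ s, BddMeas (φ i)) : BddMeas fun x => ∏ i ∈ s, φ i x := by
  induction s using Finset.induction_on with
  | empty => simpa using BddMeas.const 1
  | insert i s hi ih =>
    simp only [Finset.prod_insert hi]
    exact (hφ i (Finset.mem_insert_self i s)).mul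
      (ih fun j hj => hφ j (Finset.mem_insert_of_mem hj))

variable (M0 : Measure X) (M : ℕ → Kernel X X) {G : ℕ → X → ℝ}

lemma muB_zero (b : ℕ → Bool) {F : X × X → ℝ} (hF : BddMeas F) :
    muB M0 M G 0 b F = ∫ q, F q ∂(pairInit M0 b) := by
  simp only [muB, markovPath, Finset.range_zero, Finset.prod_empty, mul_one]
  rw [integral_map (by fun_prop) (hF.comp (measurable_pi_apply 0)).1.aestronglyMeasurable]

variable [IsProbabilityMeasure M0] [∀ p, IsMarkovKernel (M p)]

lemma muB_succ {k : ℕ} (hG : ∀ p < k + 1, BddMeas (G p)) (b : ℕ → Bool) {F : X × X → ℝ}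
    (hF : BddMeas F) : muB M0 M G (k + 1) b F =
      muB M0 M G k b fun q => G k q.1 * G k q.2 * ∫ q', F q' ∂(pairKer M b (k + 1) q) := by
  have hK : pairKer M b = fun p q => pairKernel M b p q := by
    ext p q : 2
    exact (pairKernel_apply M b p q).symm
  have hp : ∀ p ∈ Finset.range (k + 1),
      BddMeas fun ω : ℕ → X × X => G p (ω p).1 * G p (ω p).2 := fun p hp => by
    have := hG p (Finset.mem_range.1 hp)
    exact (this.comp (measurable_fst.comp (measurable_pi_apply p))).mul
      (this.comp (measurable_snd.comp (measurable_pi_apply p)))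
  unfold muB
  rw [hK, integral_markovPath_succ _ _ _
    ((hF.comp (measurable_pi_apply (k + 1))).mul (BddMeas.prod _ hp))]
  refine integral_congr_ae (Eventually.of_forall fun ω => ?_)
  have h : ∀ y, ∏ p ∈ Finset.range (k + 1), G p (Function.update ω (k + 1) y p).1 *
      G p (Function.update ω (k + 1) y p).2 =
      ∏ p ∈ Finset.range (k + 1), G p (ω p).1 * G p (ω p).2 := fun y =>
    Finset.prod_congr rfl fun p hp => by
      rw [Function.update_of_ne (Finset.mem_range.1 hp).ne]
  simp only [h, Function.update_self, integral_mul_const, Finset.prod_range_succ]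
  ring

lemma BddMeas.tmul {φ ψ : X → ℝ} (hφ : BddMeas φ) (hψ : BddMeas ψ) :
    BddMeas fun q : X × X => φ q.1 * ψ q.2 :=
  (hφ.comp measurable_fst).mul (hψ.comp measurable_snd)

lemma muB_succ_of_not {k : ℕ} (hG : ∀ p < k + 1, BddMeas (G p)) {b : ℕ → Bool}
    (hb : b (k + 1) = false) {φ ψ : X → ℝ} (hφ : BddMeas φ) (hψ : BddMeas ψ) :
    muB M0 M G (k + 1) b (fun q => φ q.1 * ψ q.2) =
      muB M0 M G k b fun q => mutate M G k φ q.1 * mutate M G k ψ q.2 := by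
  rw [muB_succ M0 M hG b (hφ.tmul hψ)]
  congr 1
  ext q
  simp only [pairKer, hb, Bool.false_eq_true, if_false, integral_prod_mul, mutate]
  ring

lemma muB_eq_mul_of_not {k : ℕ} (hG : ∀ p < k, BddMeas (G p)) (hpos : ∀ p < k, ∀ x, 0 < G p x)
    {b : ℕ → Bool} (hb : ∀ p ≤ k, b p = false) {φ ψ : X → ℝ} (hφ : BddMeas φ) (hψ : BddMeas ψ) :
    muB M0 M G k b (fun q => φ q.1 * ψ q.2) = gInt M0 M G k φ * gInt M0 M G k ψ := by
  induction k generalizing φ ψ with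
  | zero =>
    rw [muB_zero M0 M b (hφ.tmul hψ)]
    simp [pairInit, hb 0 le_rfl, integral_prod_mul, gInt, gammaFK]
  | succ k ih =>
    have hk := k.lt_succ_self
    rw [muB_succ_of_not M0 M hG (hb _ le_rfl) hφ hψ, gInt_succ M0 M G hG (hpos k hk) hφ,
      gInt_succ M0 M G hG (hpos k hk) hψ]
    exact ih (fun p hp => hG p (hp.trans hk)) (fun p hp => hpos p (hp.trans hk))
      (fun p hp => hb p (hp.trans hk.le)) (BddMeas.mutate (hG k hk) hφ)
      (BddMeas.mutate (hG k hk) hψ)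

lemma muB_eVec_self {k : ℕ} (hG : ∀ p < k, BddMeas (G p)) (hpos : ∀ p < k, ∀ x, 0 < G p x)
    {φ ψ : X → ℝ} (hφ : BddMeas φ) (hψ : BddMeas ψ) :
    muB M0 M G k (eVec k) (fun q => φ q.1 * ψ q.2) =
      gInt M0 M G k (fun x => φ x * ψ x) * gInt M0 M G k 1 := by
  cases k with
  | zero =>
    rw [muB_zero M0 M _ (hφ.tmul hψ)]
    simp only [pairInit, eVec, beq_self_eq_true, if_true]
    rw [integral_map (by fun_prop) (hφ.tmul hψ).1.aestronglyMeasurable]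
    simp [gInt, gammaFK]
  | succ k =>
    have hk := k.lt_succ_self
    rw [muB_succ M0 M hG _ (hφ.tmul hψ), gInt_succ M0 M G hG (hpos k hk) (hφ.mul hψ),
      gInt_succ M0 M G hG (hpos k hk) BddMeas.one, mutate_one,
      ← muB_eq_mul_of_not M0 M (b := eVec (k + 1)) (fun p hp => hG p (hp.trans hk))
        (fun p hp => hpos p (hp.trans hk))
        (fun p hp => by simp [eVec]; omega) (BddMeas.mutate (hG k hk) (hφ.mul hψ)) (hG k hk)]
    congr 1
    ext q
    simp only [pairKer, eVec, beq_self_eq_true, if_true, mutate]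
    rw [integral_map (by fun_prop) (hφ.tmul hψ).1.aestronglyMeasurable]
    ring

lemma sameEveLimit_eq (c : ℕ → ℝ) {k : ℕ} (hG : ∀ p < k, BddMeas (G p))
    (hpos : ∀ p < k, ∀ x, 0 < G p x) {φ ψ : X → ℝ} (hφ : BddMeas φ) (hψ : BddMeas ψ) :
    sameEveLimit M0 M G c k φ ψ = (∑ p ∈ Finset.range (k + 1),
      (c p)⁻¹ * muB M0 M G k (eVec p) fun q => φ q.1 * ψ q.2) / gInt M0 M G k 1 ^ 2 := by
  have h1 := gInt_pos M0 M G hG hpos BddMeas.one fun _ => one_pos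
  have hdiag := muB_eVec_self M0 M hG hpos hφ hψ
  induction k generalizing φ ψ with
  | zero =>
    simp only [sameEveLimit, zero_add, Finset.sum_range_one, hdiag, eInt]
    field_simp
  | succ k ih =>
    have hk := k.lt_succ_self
    have hG' : ∀ p < k, BddMeas (G p) := fun p hp => hG p (hp.trans hk)
    have hpos' : ∀ p < k, ∀ x, 0 < G p x := fun p hp => hpos p (hp.trans hk)
    have h1' := gInt_pos M0 M G hG' hpos' BddMeas.one fun _ => one_pos
    have hmφ := BddMeas.mutate (M := M) (hG k hk) hφ
    have hmψ := BddMeas.mutate (M := M) (hG k hk) hψ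
    simp only [sameEveLimit]
    rw [ih hG' hpos' hmφ hmψ h1' (muB_eVec_self M0 M hG' hpos' hmφ hmψ),
      Finset.sum_range_succ _ (k + 1), hdiag]
    have hsum : ∀ p ∈ Finset.range (k + 1),
        (c p)⁻¹ * muB M0 M G (k + 1) (eVec p) (fun q => φ q.1 * ψ q.2) =
        (c p)⁻¹ * muB M0 M G k (eVec p) fun q => mutate M G k φ q.1 * mutate M G k ψ q.2 :=
      fun p hp => by
        rw [muB_succ_of_not M0 M hG _ hφ hψ]
        have := Finset.mem_range.1 hp
        simp only [eVec, beq_eq_false_iff_ne]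
        omega
    have hg : gInt M0 M G (k + 1) 1 = gInt M0 M G k (G k) := by
      rw [gInt_succ M0 M G hG (hpos k hk) BddMeas.one, mutate_one]
    rw [Finset.sum_congr rfl hsum, eInt, eInt, ← hg]
    field_simp
    ring

lemma sigma2_eq (c : ℕ → ℝ) {n : ℕ} (hG : ∀ p < n, BddMeas (G p))
    (hpos : ∀ p < n, ∀ x, 0 < G p x) {φ : X → ℝ} (hφ : BddMeas φ) :
    sigma2 M0 M G c n φ = sameEveLimit M0 M G c n φ φ -
      (∑ p ∈ Finset.range (n + 1), (c p)⁻¹) * eInt M0 M G n φ ^ 2 := by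
  have h0 : muB M0 M G n zeroVec (tens φ) = gInt M0 M G n φ * gInt M0 M G n φ :=
    muB_eq_mul_of_not M0 M hG hpos (fun _ _ => rfl) hφ hφ
  rw [sameEveLimit_eq M0 M c hG hpos hφ hφ, eInt, div_pow, ← mul_div_assoc, ← sub_div,
    Finset.sum_mul, ← Finset.sum_sub_distrib, Finset.sum_div]
  refine Finset.sum_congr rfl fun p _ => ?_
  rw [vpn, h0, ← sq]
  unfold tens
  ring

end Variance

/-! ### The variance estimator -/

section Estimator

lemma sum_ne_eve_eq {X : Type*} {Np : ℕ → ℕ} {n : ℕ} (hn : 0 < Np n) (φ : X → ℝ)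
    (ω : (ℕ → ℕ → X) × (ℕ → ℕ → ℕ)) :
    (∑ i ∈ Finset.range (Np n), ∑ j ∈ Finset.range (Np n),
      if eve ω.2 n i ≠ eve ω.2 n j then φ (ω.1 n i) * φ (ω.1 n j) else 0) =
      (Np n : ℝ) ^ 2 * (etaN Np n φ ω ^ 2 - sameEve Np n φ φ ω) := by
  have hm : (Np n : ℝ) ≠ 0 := Nat.cast_ne_zero.2 hn.ne'
  have hs : (Np n : ℝ) ^ 2 * etaN Np n φ ω ^ 2 = ∑ i ∈ Finset.range (Np n),
      ∑ j ∈ Finset.range (Np n), φ (ω.1 n i) * φ (ω.1 n j) := by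
    rw [← Finset.sum_mul_sum, etaN]
    field_simp
  rw [mul_sub, hs, sameEve, ← mul_assoc, ← mul_pow, mul_inv_cancel₀ hm, one_pow, one_mul,
    ← Finset.sum_sub_distrib]
  refine Finset.sum_congr rfl fun i _ => ?_
  rw [← Finset.sum_sub_distrib]
  refine Finset.sum_congr rfl fun j _ => ?_
  by_cases h : eve ω.2 n i = eve ω.2 n j <;> simp [h]

lemma Vest_eq {X : Type*} {Np : ℕ → ℕ} {n : ℕ} (hn : 0 < Np n) (φ : X → ℝ)
    (ω : (ℕ → ℕ → X) × (ℕ → ℕ → ℕ)) :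
    Vest Np n φ ω = (∏ p ∈ Finset.range (n + 1), (Np p : ℝ) / ((Np p : ℝ) - 1)) *
      sameEve Np n φ φ ω -
      (∏ p ∈ Finset.range (n + 1), (Np p : ℝ) / ((Np p : ℝ) - 1) - 1) * etaN Np n φ ω ^ 2 := by
  have hm : (Np n : ℝ) ≠ 0 := Nat.cast_ne_zero.2 hn.ne'
  rw [Vest, sum_ne_eve_eq hn, Finset.prod_range_succ, mul_inv,
    div_eq_mul_inv (Np n : ℝ)]
  generalize ((Np n : ℝ) - 1)⁻¹ = t
  field_simp
  ring

lemma tendsto_npart_div {c : ℕ → ℝ} {p : ℕ} (hc : 0 < c p) :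
    Tendsto (fun N : ℕ => (npart c N p : ℝ) / ((npart c N p : ℝ) - 1)) atTop (nhds 1) := by
  have h := ((tendsto_const_nhds (x := (1 : ℝ))).sub (tendsto_inv_npart hc)).inv₀ (by simp)
  rw [sub_zero, inv_one] at h
  refine h.congr' ?_
  filter_upwards [(tendsto_npart_atTop hc).eventually_gt_atTop 0] with N hN
  have : (npart c N p : ℝ) ≠ 0 := Nat.cast_ne_zero.2 hN.ne'
  rw [← inv_div, sub_div, div_self this, one_div]

lemma tendsto_mul_prod_sub_one {c : ℕ → ℝ} {k : ℕ} (hc : ∀ p < k, 0 < c p) :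
    Tendsto (fun N : ℕ => (N : ℝ) *
      (∏ p ∈ Finset.range k, (npart c N p : ℝ) / ((npart c N p : ℝ) - 1) - 1)) atTop
      (nhds (∑ p ∈ Finset.range k, (c p)⁻¹)) := by
  induction k with
  | zero => simp
  | succ k ih =>
    have hk := hc k k.lt_succ_self
    have hQ := tendsto_npart_div hk
    have h := ((ih fun p hp => hc p (hp.trans k.lt_succ_self)).mul hQ).add
      ((tendsto_mul_inv_npart hk).mul hQ)
    rw [mul_one, mul_one, ← Finset.sum_range_succ] at h
    refine h.congr' ?_
    filter_upwards [(tendsto_npart_atTop hk).eventually_gt_atTop 1] with N hN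
    have h1 : (1 : ℝ) < npart c N k := by exact_mod_cast hN
    have h0 : (npart c N k : ℝ) ≠ 0 := by positivity
    have h2 : (npart c N k : ℝ) - 1 ≠ 0 := by linarith
    rw [Finset.prod_range_succ]
    field_simp
    ring

lemma etaN_sub_const {X : Type*} {Np : ℕ → ℕ} {n : ℕ} (hn : 0 < Np n) (φ : X → ℝ) (a : ℝ)
    (ω : (ℕ → ℕ → X) × (ℕ → ℕ → ℕ)) :
    etaN Np n (fun x => φ x - a) ω = etaN Np n φ ω - a := by
  have hm : (Np n : ℝ) ≠ 0 := Nat.cast_ne_zero.2 hn.ne'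
  simp only [etaN, Finset.sum_sub_distrib, Finset.sum_const, Finset.card_range, nsmul_eq_mul,
    mul_sub]
  rw [inv_mul_cancel_left₀ hm]

lemma sameEve_sub_const {X : Type*} (Np : ℕ → ℕ) (n : ℕ) (φ : X → ℝ) (a : ℝ)
    (ω : (ℕ → ℕ → X) × (ℕ → ℕ → ℕ)) :
    sameEve Np n (fun x => φ x - a) (fun x => φ x - a) ω = sameEve Np n φ φ ω -
      a * (sameEve Np n φ 1 ω + sameEve Np n 1 φ ω) + a ^ 2 * sameEve Np n 1 1 ω := by
  simp only [sameEve, ← mul_add, Finset.mul_sum, ← Finset.sum_add_distrib,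
    ← Finset.sum_sub_distrib]
  refine Finset.sum_congr rfl fun i _ => Finset.sum_congr rfl fun j _ => ?_
  split_ifs
  · simp only [Pi.one_apply]; ring
  · simp

variable {X : Type*} [MeasurableSpace X] [Nonempty X] (M0 : Measure X) [IsProbabilityMeasure M0]
  (M : ℕ → Kernel X X) [∀ p, IsMarkovKernel (M p)] {G : ℕ → X → ℝ}

/-- Consistency of the variance estimator, for a test function shifted by an asymptotically
negligible random constant. -/
lemma tendsto_mul_Vest {c : ℕ → ℝ} {n : ℕ} (hG : ∀ p < n, BddMeas (G p))
    (hpos : ∀ p < n, ∀ x, 0 < G p x) (hc : ∀ p < n + 1, 0 < c p) {φ : X → ℝ} (hφ : BddMeas φ)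
    {a : ℕ × ((ℕ → ℕ → X) × (ℕ → ℕ → ℕ)) → ℝ}
    (ha : Tendsto a (pfFilter M0 M G c n) (nhds 0)) :
    Tendsto (fun x => x.1 * Vest (npart c x.1) n (fun y => φ y - a x) x.2) (pfFilter M0 M G c n)
      (nhds (sigma2 M0 M G c n φ)) := by
  have hfst : Tendsto Prod.fst (pfFilter M0 M G c n) atTop := tendsto_fst_probFilter _
  have hS := fun {φ ψ : X → ℝ} (hφ : BddMeas φ) (hψ : BddMeas ψ) =>
    tendsto_mul_sameEve (M0 := M0) (M := M) hG hpos hc hφ hψ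
  have hcoef := (tendsto_mul_prod_sub_one hc).comp hfst
  have hprod := (tendsto_finsetProd (Finset.range (n + 1)) fun p hp =>
    tendsto_npart_div (hc p (Finset.mem_range.1 hp))).comp hfst
  have hsame := ((hS hφ hφ).sub (ha.mul ((hS hφ BddMeas.one).add (hS BddMeas.one hφ)))).add
    ((ha.pow 2).mul (hS BddMeas.one BddMeas.one))
  have h := (hprod.mul hsame).sub (hcoef.mul (((tendsto_etaN hG hpos hc hφ).sub ha).pow 2))
  rw [sigma2_eq M0 M c hG hpos hφ]
  simp only [Finset.prod_const_one, one_mul, zero_mul, sub_zero, ne_eq, OfNat.ofNat_ne_zero,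
    not_false_eq_true, zero_pow, add_zero] at h
  refine h.congr' ?_
  filter_upwards [hfst.eventually (eventually_npart_pos hc)] with x hx
  have hn := hx n n.lt_succ_self
  rw [Vest_eq hn, etaN_sub_const hn, sameEve_sub_const]
  simp only [Function.comp_apply]
  ring

end Estimator

theorem statement3
    {X : Type*} [MeasurableSpace X] [Nonempty X] (hX : ∃ x y : X, x ≠ y) (n : ℕ)
    (M0 : Measure X) [IsProbabilityMeasure M0]
    (M : ℕ → Kernel X X) [∀ p, IsMarkovKernel (M p)]
    (G : ℕ → X → ℝ) (hGm : ∀ p ≤ n, Measurable (G p))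
    (hGpos : ∀ p ≤ n, ∀ x, 0 < G p x) (hGbd : ∀ p ≤ n, ∃ C, ∀ x, G p x ≤ C)
    (c : ℕ → ℝ) (hc : ∀ p ≤ n, 0 < c p)
    (φ : X → ℝ) (hφm : Measurable φ) (hφb : ∃ C, ∀ x, |φ x| ≤ C) :
    (∀ ε : ℝ, 0 < ε →
      Tendsto (fun N : ℕ =>
          pfLaw M0 M G (npart c N) n
            {ω | ε ≤ |(N : ℝ) * Vest (npart c N) n φ ω - sigma2 M0 M G c n φ|})
        atTop (nhds 0)) ∧
    (∀ ε : ℝ, 0 < ε →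
      Tendsto (fun N : ℕ =>
          pfLaw M0 M G (npart c N) n
            {ω | ε ≤ |(N : ℝ) * Vest (npart c N) n
                  (fun x => φ x - etaN (npart c N) n φ ω) ω
                - sigma2 M0 M G c n fun x => φ x - eInt M0 M G n φ|})
        atTop (nhds 0)) := by
  have hG : ∀ p < n, BddMeas (G p) := fun p hp => by
    obtain ⟨C, hC⟩ := hGbd p hp.le
    exact ⟨hGm p hp.le, C, fun x => by rw [abs_of_pos (hGpos p hp.le x)]; exact hC x⟩
  have hpos : ∀ p < n, ∀ x, 0 < G p x := fun p hp => hGpos p hp.le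
  have hc' : ∀ p < n + 1, 0 < c p := fun p hp => hc p (Nat.lt_succ_iff.1 hp)
  have hφ : BddMeas φ := ⟨hφm, hφb⟩
  refine ⟨?_, ?_⟩
  · have h := tendsto_mul_Vest M0 M hG hpos hc' hφ tendsto_const_nhds
    simp only [sub_zero] at h
    rw [pfFilter, tendsto_probFilter_iff] at h
    exact h
  · have ha := (tendsto_etaN (M0 := M0) (M := M) hG hpos hc' hφ).sub_const (eInt M0 M G n φ)
    rw [sub_self] at ha
    have h := tendsto_mul_Vest M0 M hG hpos hc' (hφ.sub (BddMeas.const (eInt M0 M G n φ))) ha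
    simp only [sub_sub_sub_cancel_right] at h
    rw [pfFilter, tendsto_probFilter_iff] at h
    exact h
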